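/- The third homotopy group of SO(4) is free abelian of rank two: there is a group isomorphism π₃(SO(4), 1) ≅ ℤ × ℤ, where SO(4) is the topological group of real 4×4 matrices A satisfying Aᵀ * A = 1 and det A = 1, with the subspace topology from the space of 4×4 real matrices and basepoint the identity matrix. -/

import Mathlib

open Topology Matrix

/-- `SO(4)` as the space of real 4×4 matrices `A` with `Aᵀ * A = 1` and `det A = 1`,
with the subspace topology induced from the space of 4×4 real matrices. -/
abbrev SO4 : Type := {A : Matrix (Fin 4) (Fin 4) ℝ // Aᵀ * A = 1 ∧ A.det = 1}

/-- The identity matrix, as the basepoint of `SO(4)`. -/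
def so4One : SO4 := ⟨1, by simp⟩

open scoped Quaternion unitInterval

noncomputable section

/-- The unit quaternions, a topological group homeomorphic to the three-sphere. -/
abbrev UnitQuat : Type := Metric.sphere (0 : Quaternion ℝ) 1

/-- Real four-space, split as real part and vector part of a quaternion. -/
abbrev ReVec : Type := ℝ × (Fin 3 → ℝ)

namespace ReVec

/-- The quaternion with given real and vector parts. -/
def toQuat (v : ReVec) : Quaternion ℝ := ⟨v.1, v.2 0, v.2 1, v.2 2⟩

/-- The real and vector parts of a quaternion. -/
def ofQuat (q : Quaternion ℝ) : ReVec := (q.re, ![q.imI, q.imJ, q.imK])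

@[simp] lemma toQuat_ofQuat (q : Quaternion ℝ) : toQuat (ofQuat q) = q := by
  ext <;> simp [toQuat, ofQuat]

@[simp] lemma ofQuat_toQuat (v : ReVec) : ofQuat (toQuat v) = v := by
  refine Prod.ext rfl ?_
  ext i
  fin_cases i <;> rfl

lemma toQuat_smul (c : ℝ) (v : ReVec) : toQuat (c • v) = c • toQuat v := by
  apply Quaternion.ext <;> rfl

lemma ofQuat_smul (c : ℝ) (q : Quaternion ℝ) : ofQuat (c • q) = c • ofQuat q := by
  rw [← toQuat_ofQuat q, ← toQuat_smul]
  simp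

lemma toQuat_eq_zero {v : ReVec} : toQuat v = 0 ↔ v = 0 := by
  constructor
  · intro h
    have := congrArg ofQuat h
    rw [ofQuat_toQuat] at this
    rw [this]
    refine Prod.ext rfl ?_
    ext i
    fin_cases i <;> rfl
  · rintro rfl
    rfl

lemma toQuat_add (v w : ReVec) : toQuat (v + w) = toQuat v + toQuat w := by
  apply Quaternion.ext <;> rfl

lemma continuous_toQuat : Continuous toQuat :=
  LinearMap.continuous_of_finiteDimensional
    ({ toFun := toQuat, map_add' := toQuat_add, map_smul' := toQuat_smul } : ReVec →ₗ[ℝ] Quaternion ℝ)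

lemma continuous_ofQuat : Continuous ofQuat := by
  refine Quaternion.continuous_re.prodMk (continuous_pi fun i => ?_)
  fin_cases i
  · exact Quaternion.continuous_imI
  · exact Quaternion.continuous_imJ
  · exact Quaternion.continuous_imK

open Classical in
/-- Radial projection of a nonzero vector to the unit quaternions. -/
def normalize (v : ReVec) : UnitQuat :=
  if h : v = 0 then 1 else
    ⟨‖toQuat v‖⁻¹ • toQuat v, by
      have : ‖toQuat v‖ ≠ 0 := by simpa [toQuat_eq_zero] using h
      simp [norm_smul, this]⟩

lemma coe_normalize {v : ReVec} (h : v ≠ 0) :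
    (normalize v : Quaternion ℝ) = ‖toQuat v‖⁻¹ • toQuat v := by
  simp [normalize, h]

lemma norm_toQuat_pos {v : ReVec} (h : v ≠ 0) : 0 < ‖toQuat v‖ := by
  simpa [toQuat_eq_zero] using h

lemma continuousOn_normalize : ContinuousOn normalize {v | v ≠ 0} := by
  rw [continuousOn_iff_continuous_domRestrict, Topology.IsInducing.subtypeVal.continuous_iff]
  have : Subtype.val ∘ Set.domRestrict {v : ReVec | v ≠ 0} normalize =
      fun v : {v : ReVec | v ≠ 0} => ‖toQuat (v : ReVec)‖⁻¹ • toQuat (v : ReVec) := by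
    funext v
    exact coe_normalize v.2
  rw [this]
  have h : Continuous fun v : {v : ReVec | v ≠ 0} => toQuat v :=
    continuous_toQuat.comp continuous_subtype_val
  exact (h.norm.inv₀ fun v => (norm_toQuat_pos v.2).ne').smul h

lemma normalize_smul {c : ℝ} (hc : 0 < c) (v : ReVec) : normalize (c • v) = normalize v := by
  by_cases h : v = 0
  · simp [h]
  · apply Subtype.ext
    rw [coe_normalize h, coe_normalize (smul_ne_zero hc.ne' h), toQuat_smul, norm_smul, smul_smul,
      Real.norm_of_nonneg hc.le, _root_.mul_inv_rev, mul_assoc, inv_mul_cancel₀ hc.ne', mul_one]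

lemma normalize_eq_one {v : ReVec} (h1 : 0 < v.1) (h2 : v.2 = 0) : normalize v = 1 := by
  have h : v = v.1 • ((1, 0) : ReVec) := by
    ext <;> simp [h2]
  rw [h, normalize_smul h1]
  apply Subtype.ext
  have h0 : ((1, 0) : ReVec) ≠ 0 := by simp [Prod.ext_iff]
  have h3 : toQuat ((1, 0) : ReVec) = 1 := rfl
  rw [coe_normalize h0, h3]
  simp

end ReVec

open ReVec

namespace UnitQuat

/-- Coordinates of a unit quaternion. -/
def coords (q : UnitQuat) : ReVec := ofQuat q

lemma continuous_coords : Continuous coords := continuous_ofQuat.comp continuous_subtype_val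

@[simp] lemma normalize_coords (q : UnitQuat) : normalize (coords q) = q := by
  have h1 : ‖(q : Quaternion ℝ)‖ = 1 := by simp
  have h : coords q ≠ 0 := by
    intro h0
    rw [← toQuat_eq_zero, coords, toQuat_ofQuat] at h0
    rw [h0, norm_zero] at h1
    exact zero_ne_one h1
  apply Subtype.ext
  rw [coe_normalize h, coords, toQuat_ofQuat, h1]
  simp

@[simp] lemma coords_one : coords 1 = (1, 0) := by
  refine Prod.ext ?_ ?_
  · simp [coords, ofQuat]
  · ext i
    fin_cases i <;> simp [coords, ofQuat]

lemma coords_normalize {v : ReVec} (h : v ≠ 0) :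
    coords (normalize v) = ‖toQuat v‖⁻¹ • v := by
  rw [coords, coe_normalize h, ofQuat_smul, ofQuat_toQuat]

lemma half_le_norm_coords (q : UnitQuat) : 1 / 2 ≤ ‖coords q‖ := by
  by_contra! hlt
  have h1 : ‖(q : Quaternion ℝ)‖ = 1 := by simp
  have h2 := Quaternion.normSq_eq_norm_mul_self (q : Quaternion ℝ)
  rw [h1, Quaternion.normSq_def'] at h2
  have hre : |(q : Quaternion ℝ).re| < 1 / 2 :=
    lt_of_le_of_lt (norm_fst_le (coords q)) hlt
  have him (i : Fin 3) : |(coords q).2 i| < 1 / 2 :=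
    lt_of_le_of_lt ((norm_le_pi_norm _ i).trans (norm_snd_le (coords q))) hlt
  have hi := him 0
  have hj := him 1
  have hk := him 2
  simp only [coords, ofQuat, Matrix.cons_val] at hi hj hk
  rw [← sq_lt_sq₀ (abs_nonneg _) (by norm_num), sq_abs] at hre hi hj hk
  linarith

lemma coords_ne_zero (q : UnitQuat) : coords q ≠ 0 := by
  have := half_le_norm_coords q
  intro h
  rw [h] at this
  norm_num at this

end UnitQuat

open UnitQuat

/-- Pointwise product of generalized loops in a topological group. -/
def GenLoop.pointwiseMul {N G : Type*} [TopologicalSpace G] [Group G] [IsTopologicalGroup G]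
    (f g : GenLoop N G 1) : GenLoop N G 1 :=
  ⟨f.1 * g.1, fun y hy => by
    have h1 := f.2 y hy
    have h2 := g.2 y hy
    simp [h1, h2]⟩

namespace HomotopyGroup

/-- The homotopy class of a generalized loop. -/
def mk {N X : Type*} [TopologicalSpace X] {x : X} (f : GenLoop N X x) : HomotopyGroup N X x := ⟦f⟧

section

variable {N X : Type*} [TopologicalSpace X] {x : X}

lemma mk_eq_mk_iff {f g : GenLoop N X x} : mk f = mk g ↔ GenLoop.Homotopic f g := Quotient.eq

lemma mk_surjective : Function.Surjective (mk : GenLoop N X x → HomotopyGroup N X x) :=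
  Quotient.exists_rep

variable [DecidableEq N] [Nonempty N]

lemma mk_mul_mk (i : N) (f g : GenLoop N X x) : mk f * mk g = mk (GenLoop.transAt i g f) :=
  mul_spec

lemma mk_const : mk (GenLoop.const : GenLoop N X x) = 1 := rfl

lemma mk_inv (i : N) (f : GenLoop N X x) : (mk f)⁻¹ = mk (GenLoop.symmAt i f) :=
  inv_spec

end

/-- In a topological group, the pointwise product represents the product of homotopy classes. -/
lemma mk_pointwiseMul {N G : Type*} [DecidableEq N] [Nonempty N] [TopologicalSpace G] [Group G]
    [IsTopologicalGroup G] (f g : GenLoop N G 1) :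
    mk (GenLoop.pointwiseMul f g) = mk g * mk f := by
  obtain ⟨i⟩ := ‹Nonempty N›
  have hf : mk (GenLoop.transAt i f GenLoop.const) = mk f := by
    rw [← mk_mul_mk, mk_const, one_mul]
  have hg : mk (GenLoop.transAt i GenLoop.const g) = mk g := by
    rw [← mk_mul_mk, mk_const, mul_one]
  have key : GenLoop.transAt i f g = GenLoop.pointwiseMul
      (GenLoop.transAt i f GenLoop.const) (GenLoop.transAt i GenLoop.const g) := by
    ext y
    change _ = (GenLoop.transAt i f GenLoop.const) y * (GenLoop.transAt i GenLoop.const g) y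
    simp only [GenLoop.transAt, GenLoop.coe_copy]
    split_ifs <;> simp
  rw [mk_mul_mk i, key]
  obtain ⟨F⟩ := mk_eq_mk_iff.1 hf
  obtain ⟨H⟩ := mk_eq_mk_iff.1 hg
  refine mk_eq_mk_iff.2 ⟨ContinuousMap.HomotopyRel.symm
    ⟨⟨⟨fun z => F z * H z, by fun_prop⟩, fun x => ?_, fun x => ?_⟩, fun t x hx => ?_⟩⟩
  · simp [GenLoop.pointwiseMul]
  · simp [GenLoop.pointwiseMul]
  · have h1 := F.eq_fst t hx
    have h2 := H.eq_fst t hx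
    simp [GenLoop.pointwiseMul] at h1 h2 ⊢
    rw [h1, h2]

end HomotopyGroup

/-- A family of nonvanishing vectors that are positive reals on the boundary of the cube gives a
homotopy of generalized loops after normalization. -/
lemma homotopic_of_normalize {N : Type*} {f g : GenLoop N UnitQuat 1} (H : I × (N → I) → ReVec)
    (hc : Continuous H) (hne : ∀ z, H z ≠ 0)
    (hb : ∀ t, ∀ x ∈ Cube.boundary N, 0 < (H (t, x)).1 ∧ (H (t, x)).2 = 0)
    (h0 : ∀ x, f x = normalize (H (0, x))) (h1 : ∀ x, g x = normalize (H (1, x))) :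
    GenLoop.Homotopic f g := by
  refine ⟨⟨⟨⟨fun z => normalize (H z), ?_⟩, fun x => (h0 x).symm, fun x => (h1 x).symm⟩, ?_⟩⟩
  · exact continuousOn_normalize.comp_continuous hc hne
  · intro t x hx
    have : f.1 x = 1 := f.2 x hx
    rw [this]
    exact normalize_eq_one (hb t x hx).1 (hb t x hx).2

/-- The real coordinates of a point of the unit cube. -/
def cubeVal (x : Fin 3 → I) : Fin 3 → ℝ := fun i => x i

/-- The centre of the unit cube. -/
def cubeCenter : Fin 3 → ℝ := fun _ => 1 / 2

@[fun_prop]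
lemma continuous_cubeVal : Continuous cubeVal :=
  continuous_pi fun i => continuous_subtype_val.comp (continuous_apply i)

lemma norm_cubeVal_sub_center_le (x : Fin 3 → I) : ‖cubeVal x - cubeCenter‖ ≤ 1 / 2 := by
  rw [pi_norm_le_iff_of_nonneg (by norm_num)]
  intro i
  have h0 := (x i).2.1
  have h1 := (x i).2.2
  rw [Real.norm_eq_abs, abs_le]
  simp only [cubeVal, cubeCenter, Pi.sub_apply]
  constructor <;> linarith

lemma norm_cubeVal_sub_center {x : Fin 3 → I} (hx : x ∈ Cube.boundary (Fin 3)) :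
    ‖cubeVal x - cubeCenter‖ = 1 / 2 := by
  refine le_antisymm (norm_cubeVal_sub_center_le x) ?_
  obtain ⟨i, hi⟩ := hx
  refine le_trans ?_ (norm_le_pi_norm _ i)
  rw [Real.norm_eq_abs]
  rcases hi with hi | hi <;> simp [cubeVal, cubeCenter, hi, abs_of_pos] <;> norm_num

lemma isClosed_cubeBoundary {N : Type*} [Finite N] : IsClosed (Cube.boundary N) := by
  have : Cube.boundary N = ⋃ i, {y : N → I | y i = 0 ∨ y i = 1} := by
    ext y
    simp [Cube.boundary]
  rw [this]
  refine isClosed_iUnion_of_finite fun i => ?_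
  exact (isClosed_eq (continuous_apply i) continuous_const).union
    (isClosed_eq (continuous_apply i) continuous_const)

/-- A nonvanishing map to four-space whose normalization is the identity away from a ball. -/
def bumpVec (y : Fin 3 → ℝ) : ReVec := (‖y‖ ^ 2 - 1 / 2, max 0 (1 - ‖y‖) • y)

lemma bumpVec_ne_zero (y : Fin 3 → ℝ) : bumpVec y ≠ 0 := by
  intro h
  have h1 : ‖y‖ ^ 2 - 1 / 2 = 0 := congrArg Prod.fst h
  have h2 : max 0 (1 - ‖y‖) • y = 0 := congrArg Prod.snd h
  rcases smul_eq_zero.1 h2 with h3 | rfl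
  · have : 1 - ‖y‖ ≤ 0 := (le_max_right _ _).trans h3.le
    nlinarith
  · norm_num at h1

lemma continuous_bumpVec : Continuous bumpVec := by
  unfold bumpVec
  fun_prop

lemma bumpVec_of_one_le_norm {y : Fin 3 → ℝ} (h : 1 ≤ ‖y‖) :
    0 < (bumpVec y).1 ∧ (bumpVec y).2 = 0 := by
  refine ⟨?_, ?_⟩
  · simp only [bumpVec]
    nlinarith
  · have : max 0 (1 - ‖y‖) = 0 := max_eq_left (by linarith)
    simp [bumpVec, this]

/-- The standard degree-one bump: the closed unit ball modulo its boundary, wrapped once around the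
unit quaternions. -/
def bump (y : Fin 3 → ℝ) : UnitQuat := normalize (bumpVec y)

lemma continuous_bump : Continuous bump :=
  continuousOn_normalize.comp_continuous continuous_bumpVec bumpVec_ne_zero

lemma bump_eq_one {y : Fin 3 → ℝ} (h : 1 ≤ ‖y‖) : bump y = 1 :=
  normalize_eq_one (bumpVec_of_one_le_norm h).1 (bumpVec_of_one_le_norm h).2

/-- The loop obtained from the bump and a map sending the boundary of the cube outside the open unit
ball. -/
def bumpLoop (L : C(Fin 3 → I, Fin 3 → ℝ)) (hL : ∀ x ∈ Cube.boundary (Fin 3), 1 ≤ ‖L x‖) :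
    GenLoop (Fin 3) UnitQuat 1 :=
  ⟨⟨fun x => bump (L x), continuous_bump.comp L.continuous⟩, fun x hx => bump_eq_one (hL x hx)⟩

lemma bumpLoop_homotopic {L₀ L₁ : C(Fin 3 → I, Fin 3 → ℝ)}
    {h₀ : ∀ x ∈ Cube.boundary (Fin 3), 1 ≤ ‖L₀ x‖} {h₁ : ∀ x ∈ Cube.boundary (Fin 3), 1 ≤ ‖L₁ x‖}
    (H : I × (Fin 3 → I) → Fin 3 → ℝ) (hc : Continuous H)
    (hb : ∀ t, ∀ x ∈ Cube.boundary (Fin 3), 1 ≤ ‖H (t, x)‖)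
    (H0 : ∀ x, H (0, x) = L₀ x) (H1 : ∀ x, H (1, x) = L₁ x) :
    HomotopyGroup.mk (bumpLoop L₀ h₀) = HomotopyGroup.mk (bumpLoop L₁ h₁) :=
  HomotopyGroup.mk_eq_mk_iff.2 <| homotopic_of_normalize (fun z => bumpVec (H z))
    (continuous_bumpVec.comp hc) (fun _ => bumpVec_ne_zero _)
    (fun t x hx => bumpVec_of_one_le_norm (hb t x hx))
    (fun x => by rw [H0]; rfl) (fun x => by rw [H1]; rfl)

/-- The affine map `x ↦ A (x - p)` on the cube. -/
def cubeAffine (A : Matrix (Fin 3) (Fin 3) ℝ) (p : Fin 3 → ℝ) : C(Fin 3 → I, Fin 3 → ℝ) :=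
  ⟨fun x => A *ᵥ (cubeVal x - p), by fun_prop⟩

/-- The diagonal matrix with `-1` at places in `T` and `1` elsewhere. -/
def signDiag (T : Finset (Fin 3)) : Matrix (Fin 3) (Fin 3) ℝ :=
  diagonal fun i => if i ∈ T then -1 else 1

lemma norm_signDiag_mulVec (T : Finset (Fin 3)) (v : Fin 3 → ℝ) : ‖signDiag T *ᵥ v‖ = ‖v‖ := by
  have h (i : Fin 3) : ‖(signDiag T *ᵥ v) i‖ = ‖v i‖ := by
    rw [signDiag, mulVec_diagonal]
    split_ifs <;> simp
  refine le_antisymm ?_ ?_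
  · exact (pi_norm_le_iff_of_nonneg (norm_nonneg _)).2 fun i => (h i).le.trans (norm_le_pi_norm _ i)
  · exact (pi_norm_le_iff_of_nonneg (norm_nonneg _)).2 fun i => (h i).ge.trans (norm_le_pi_norm _ i)

lemma one_le_norm_two_smul_signDiag (T : Finset (Fin 3)) :
    ∀ x ∈ Cube.boundary (Fin 3), 1 ≤ ‖cubeAffine ((2 : ℝ) • signDiag T) cubeCenter x‖ := by
  intro x hx
  change 1 ≤ ‖((2 : ℝ) • signDiag T) *ᵥ (cubeVal x - cubeCenter)‖
  rw [smul_mulVec, norm_smul, norm_signDiag_mulVec, norm_cubeVal_sub_center hx]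
  norm_num

/-- The bump loop reflected in the coordinates in `T`. -/
def signLoop (T : Finset (Fin 3)) : GenLoop (Fin 3) UnitQuat 1 :=
  bumpLoop (cubeAffine ((2 : ℝ) • signDiag T) cubeCenter) (one_le_norm_two_smul_signDiag T)

lemma signLoop_mem_zpowers (T : Finset (Fin 3)) :
    HomotopyGroup.mk (signLoop T) ∈ Subgroup.zpowers (HomotopyGroup.mk (signLoop ∅)) := by
  induction T using Finset.induction_on with
  | empty => exact Subgroup.mem_zpowers _
  | insert i T hi ih =>
    have : HomotopyGroup.mk (signLoop (insert i T)) = (HomotopyGroup.mk (signLoop T))⁻¹ := by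
      rw [HomotopyGroup.mk_inv i]
      congr 1
      ext1 x
      rw [GenLoop.symmAt, GenLoop.coe_copy]
      change bump _ = bump _
      congr 1
      change ((2 : ℝ) • signDiag _) *ᵥ (cubeVal x - cubeCenter) =
        ((2 : ℝ) • signDiag _) *ᵥ (cubeVal _ - cubeCenter)
      rw [smul_mulVec, smul_mulVec]
      congr 1
      ext j
      simp only [signDiag, mulVec_diagonal, Finset.mem_insert, Pi.sub_apply, cubeVal, cubeCenter]
      by_cases hj : j = i
      · subst hj
        simp [hi]
        ring
      · simp [hj]
    rw [this]
    exact Subgroup.inv_mem _ ih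

lemma Matrix.exists_joinedIn_signDiag (A : Matrix (Fin 3) (Fin 3) ℝ) (hA : A.det ≠ 0) :
    ∃ T, JoinedIn {M : Matrix (Fin 3) (Fin 3) ℝ | M.det ≠ 0} A (signDiag T) := by
  have hmul : ∀ {A A' B B' : Matrix (Fin 3) (Fin 3) ℝ},
      JoinedIn {M : Matrix (Fin 3) (Fin 3) ℝ | M.det ≠ 0} A A' →
      JoinedIn {M : Matrix (Fin 3) (Fin 3) ℝ | M.det ≠ 0} B B' →
      JoinedIn {M : Matrix (Fin 3) (Fin 3) ℝ | M.det ≠ 0} (A * B) (A' * B') := by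
    rintro A A' B B' ⟨γ, hγ⟩ ⟨δ, hδ⟩
    refine ⟨⟨⟨fun t => γ t * δ t, by fun_prop⟩, by simp, by simp⟩, fun t => ?_⟩
    change (γ t * δ t).det ≠ 0
    rw [det_mul]
    exact mul_ne_zero (hγ t) (hδ t)
  refine diagonal_transvection_induction_of_det_ne_zero
    (fun A => ∃ T, JoinedIn {M : Matrix (Fin 3) (Fin 3) ℝ | M.det ≠ 0} A (signDiag T)) A hA
    ?_ ?_ ?_
  · intro D hD
    rw [det_diagonal, Finset.prod_ne_zero_iff] at hD
    refine ⟨Finset.univ.filter fun i => D i < 0,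
      ⟨⟨⟨fun t : I => diagonal fun i => (1 - (t : ℝ)) * D i + t * (if D i < 0 then -1 else 1), ?_⟩,
        ?_, ?_⟩, ?_⟩⟩
    · refine Continuous.matrix_diagonal (continuous_pi fun i => ?_)
      fun_prop
    · simp
    · simp [signDiag]
    · intro t
      change (diagonal _).det ≠ 0
      rw [det_diagonal, Finset.prod_ne_zero_iff]
      intro i _
      have h0 := t.2.1
      have h1 := t.2.2
      rcases lt_or_gt_of_ne (hD i (Finset.mem_univ i)) with h | h
      · rw [if_pos h]
        apply ne_of_lt
        rcases h0.eq_or_lt with h2 | h2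
        · simpa [← h2] using h
        · nlinarith
      · rw [if_neg h.not_gt]
        apply ne_of_gt
        rcases h0.eq_or_lt with h2 | h2
        · simpa [← h2] using h
        · nlinarith
  · intro t
    refine ⟨∅, ⟨⟨⟨fun s : I => transvection t.i t.j ((1 - (s : ℝ)) * t.c), ?_⟩, ?_, ?_⟩, ?_⟩⟩
    · unfold transvection
      refine continuous_const.add ?_
      refine continuous_matrix fun a b => ?_
      simp only [single_apply]
      split_ifs <;> fun_prop
    · simp [TransvectionStruct.toMatrix]
    · simp [signDiag]
    · intro s
      change (transvection _ _ _).det ≠ 0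
      rw [det_transvection_of_ne _ _ t.hij]
      exact one_ne_zero
  · rintro A B - - ⟨T, hT⟩ ⟨S, hS⟩
    refine ⟨symmDiff T S, ?_⟩
    have : signDiag (symmDiff T S) = signDiag T * signDiag S := by
      rw [signDiag, signDiag, signDiag, diagonal_mul_diagonal]
      congr 1
      ext i
      by_cases h1 : i ∈ T <;> by_cases h2 : i ∈ S <;> simp [Finset.mem_symmDiff, h1, h2]
    rw [this]
    exact hmul hT hS

/-- A bump loop for an invertible affine map with zero in the interior of the cube is a power of the
standard one. -/
lemma bumpLoop_cubeAffine_mem_zpowers (A : Matrix (Fin 3) (Fin 3) ℝ) (hA : A.det ≠ 0)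
    (p : Fin 3 → ℝ) (hp : ‖p - cubeCenter‖ < 1 / 2)
    (h : ∀ x ∈ Cube.boundary (Fin 3), 1 ≤ ‖cubeAffine A p x‖) :
    HomotopyGroup.mk (bumpLoop (cubeAffine A p) h) ∈
      Subgroup.zpowers (HomotopyGroup.mk (signLoop ∅)) := by
  obtain ⟨T, γ, hγ⟩ := A.exists_joinedIn_signDiag hA
  let q : I → Fin 3 → ℝ := fun t => p + (t : ℝ) • (cubeCenter - p)
  have hq (t : I) : ‖q t - cubeCenter‖ < 1 / 2 := by
    have : q t - cubeCenter = (1 - (t : ℝ)) • (p - cubeCenter) := by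
      simp only [q, smul_sub, sub_smul, one_smul]
      abel
    rw [this, norm_smul, Real.norm_of_nonneg (by have := t.2.2; linarith)]
    have := t.2.1
    nlinarith [norm_nonneg (p - cubeCenter)]
  have hqc : Continuous q := by fun_prop
  let K : I × (Fin 3 → I) → Fin 3 → ℝ := fun z => γ z.1 *ᵥ (cubeVal z.2 - q z.1)
  have hK : Continuous K := by fun_prop
  have hpos : ∀ z ∈ Set.univ ×ˢ Cube.boundary (Fin 3), 0 < ‖K z‖ := by
    rintro ⟨t, x⟩ ⟨-, hx⟩
    rw [norm_pos_iff]
    intro h0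
    have h1 := Matrix.eq_zero_of_mulVec_eq_zero (hγ t) h0
    have h2 := hq t
    rw [← sub_eq_zero.1 h1, norm_cubeVal_sub_center hx] at h2
    exact lt_irrefl _ h2
  obtain ⟨m, hm, hmK⟩ : ∃ m > 0, ∀ z ∈ Set.univ ×ˢ Cube.boundary (Fin 3), m ≤ ‖K z‖ :=
    (isCompact_univ.prod isClosed_cubeBoundary.isCompact).exists_forall_le' hK.norm.continuousOn hpos
  let S : ℝ := 2 + m⁻¹
  have hS : 0 < m⁻¹ := inv_pos.2 hm
  have hS1 (t : I) (x) (hx : x ∈ Cube.boundary (Fin 3)) : 1 ≤ ‖S • K (t, x)‖ := by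
    rw [norm_smul, Real.norm_of_nonneg (by positivity)]
    have h1 := hmK (t, x) ⟨trivial, hx⟩
    calc (1 : ℝ) = m⁻¹ * m := (inv_mul_cancel₀ hm.ne').symm
      _ ≤ S * ‖K (t, x)‖ := by
        apply mul_le_mul _ h1 hm.le (by positivity)
        simp [S]
  have e1 : HomotopyGroup.mk (bumpLoop (cubeAffine A p) h) =
      HomotopyGroup.mk (bumpLoop ⟨fun x => S • K (0, x), by fun_prop⟩ (hS1 0)) := by
    refine bumpLoop_homotopic (fun z => (1 + (z.1 : ℝ) * (S - 1)) • cubeAffine A p z.2)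
      (by fun_prop) ?_ ?_ ?_
    · intro t x hx
      have h1 : 0 ≤ (t : ℝ) * (S - 1) :=
        mul_nonneg t.2.1 (by simp only [S]; linarith)
      rw [norm_smul, Real.norm_of_nonneg (by positivity)]
      nlinarith [h x hx]
    · intro x
      simp
    · intro x
      simp [K, q, cubeAffine]
  have e2 : HomotopyGroup.mk (bumpLoop ⟨fun x => S • K (0, x), by fun_prop⟩ (hS1 0)) =
      HomotopyGroup.mk (bumpLoop ⟨fun x => S • K (1, x), by fun_prop⟩ (hS1 1)) :=
    bumpLoop_homotopic (fun z => S • K z) (by fun_prop) hS1 (fun _ => rfl) (fun _ => rfl)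
  have e3 : HomotopyGroup.mk (bumpLoop ⟨fun x => S • K (1, x), by fun_prop⟩ (hS1 1)) =
      HomotopyGroup.mk (signLoop T) := by
    have hK1 (x) : K (1, x) = signDiag T *ᵥ (cubeVal x - cubeCenter) := by
      simp [K, q]
    refine bumpLoop_homotopic
      (fun z => (2 + (1 - (z.1 : ℝ)) * m⁻¹) • (signDiag T *ᵥ (cubeVal z.2 - cubeCenter)))
      (by fun_prop) ?_ ?_ ?_
    · intro t x hx
      have h1 : 0 ≤ (1 - (t : ℝ)) * m⁻¹ :=
        mul_nonneg (by linarith [t.2.2]) hS.le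
      rw [norm_smul, Real.norm_of_nonneg (by positivity), norm_signDiag_mulVec,
        norm_cubeVal_sub_center hx]
      linarith
    · intro x
      simp [hK1, S]
    · intro x
      simp [cubeAffine, smul_mulVec]
  rw [e1, e2, e3]
  exact signLoop_mem_zpowers T

/-- Real-valued functions on the cube that extend to smooth functions on the ambient space. -/
def smoothSubalgebra : Subalgebra ℝ C(Fin 3 → I, ℝ) where
  carrier := {f | ∃ P : (Fin 3 → ℝ) → ℝ, ContDiff ℝ ⊤ P ∧ ∀ x, f x = P (cubeVal x)}
  mul_mem' := by
    rintro f g ⟨P, hP, hf⟩ ⟨Q, hQ, hg⟩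
    exact ⟨P * Q, hP.mul hQ, fun x => by simp [hf, hg]⟩
  add_mem' := by
    rintro f g ⟨P, hP, hf⟩ ⟨Q, hQ, hg⟩
    exact ⟨P + Q, hP.add hQ, fun x => by simp [hf, hg]⟩
  algebraMap_mem' r := ⟨fun _ => r, contDiff_const, fun x => rfl⟩

lemma smoothSubalgebra_separatesPoints : smoothSubalgebra.SeparatesPoints := by
  intro x y hxy
  obtain ⟨i, hi⟩ := Function.ne_iff.1 hxy
  refine ⟨_, ⟨⟨fun x => (x i : ℝ), by fun_prop⟩, ⟨fun x => x i, contDiff_apply ℝ ℝ i, fun x => rfl⟩,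
    rfl⟩, ?_⟩
  simpa [Subtype.ext_iff] using hi

lemma exists_contDiff_real_near (f : C(Fin 3 → I, ℝ)) {ε : ℝ} (hε : 0 < ε) :
    ∃ P : (Fin 3 → ℝ) → ℝ, ContDiff ℝ ⊤ P ∧ ∀ x, |P (cubeVal x) - f x| < ε := by
  obtain ⟨⟨g, P, hP, hg⟩, h⟩ :=
    ContinuousMap.exists_mem_subalgebra_near_continuousMap_of_separatesPoints smoothSubalgebra
      smoothSubalgebra_separatesPoints f ε hε
  refine ⟨P, hP, fun x => ?_⟩
  rw [← hg]
  exact lt_of_le_of_lt (ContinuousMap.norm_coe_le_norm (g - f) x) h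

/-- Continuous maps from the cube to four-space are uniformly close to smooth ones. -/
lemma exists_contDiff_near (f : C(Fin 3 → I, ReVec)) {ε : ℝ} (hε : 0 < ε) :
    ∃ P : (Fin 3 → ℝ) → ReVec, ContDiff ℝ ⊤ P ∧ ∀ x, ‖P (cubeVal x) - f x‖ < ε := by
  obtain ⟨P, hP, hPf⟩ := exists_contDiff_real_near ⟨fun x => (f x).1, by fun_prop⟩ hε
  choose Q hQ hQf using fun i : Fin 3 =>
    exists_contDiff_real_near ⟨fun x => (f x).2 i, by fun_prop⟩ hε
  refine ⟨fun x => (P x, fun i => Q i x), hP.prodMk (contDiff_pi.2 hQ), fun x => ?_⟩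
  rw [Prod.norm_def, max_lt_iff, pi_norm_lt_iff hε]
  exact ⟨hPf x, fun i => hQf i x⟩

/-- A self-map of four-space concentrating the degree of normalization near the ray through
`(-1, y)`. -/
def collapse (s : ℝ) (y : Fin 3 → ℝ) (v : ReVec) : ReVec :=
  (max 0 v.1 + ‖s • (v.2 - max 0 (-v.1) • y)‖ ^ 2 - max 0 (-v.1) ^ 2 / 2,
    max 0 (max 0 (-v.1) - ‖s • (v.2 - max 0 (-v.1) • y)‖) • s • (v.2 - max 0 (-v.1) • y))

lemma continuous_collapse :
    Continuous fun z : ℝ × (Fin 3 → ℝ) × ReVec => collapse z.1 z.2.1 z.2.2 := by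
  unfold collapse
  fun_prop

lemma collapse_pos {s : ℝ} (hs : 0 < s) {y : Fin 3 → ℝ} {v : ReVec} (hv : v ≠ 0)
    (h : max 0 (-v.1) ≤ ‖s • (v.2 - max 0 (-v.1) • y)‖) :
    0 < (collapse s y v).1 ∧ (collapse s y v).2 = 0 := by
  constructor
  · simp only [collapse]
    have h1 := le_max_left 0 v.1
    have h2 := le_max_left 0 (-v.1)
    rcases lt_trichotomy v.1 0 with h3 | h3 | h3
    · have h4 : 0 < max 0 (-v.1) := lt_max_of_lt_right (by linarith)
      nlinarith
    · have h4 : max 0 (-v.1) = 0 := by simp [h3]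
      rw [h4]
      have h5 : v.2 ≠ 0 := fun h5 => hv (Prod.ext h3 h5)
      have h6 : 0 < ‖s • (v.2 - (0 : ℝ) • y)‖ := by
        rw [zero_smul, sub_zero]
        exact norm_pos_iff.2 (smul_ne_zero hs.ne' h5)
      have : 0 < ‖s • (v.2 - (0 : ℝ) • y)‖ ^ 2 := by positivity
      linarith
    · have h4 : 0 < max 0 v.1 := lt_max_of_lt_right h3
      nlinarith
  · have : max 0 (max 0 (-v.1) - ‖s • (v.2 - max 0 (-v.1) • y)‖) = 0 := max_eq_left (by linarith)
    simp [collapse, this]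

lemma collapse_pos_of_pos {s : ℝ} (hs : 0 < s) {y : Fin 3 → ℝ} {v : ReVec} (hv : 0 < v.1) :
    0 < (collapse s y v).1 ∧ (collapse s y v).2 = 0 := by
  refine collapse_pos hs (fun h => hv.ne' (congrArg Prod.fst h)) ?_
  have : max 0 (-v.1) = 0 := max_eq_left (by linarith)
  rw [this]
  exact norm_nonneg _

lemma collapse_of_neg (s : ℝ) (y : Fin 3 → ℝ) {v : ReVec} (hv : v.1 < 0) :
    collapse s y v = (-v.1) ^ 2 • bumpVec (s • ((-v.1)⁻¹ • v.2 - y)) := by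
  obtain ⟨a, w⟩ := v
  simp only at hv
  obtain ⟨r, rfl⟩ : ∃ r, a = -r := ⟨-a, by simp⟩
  have hr : 0 < r := by linarith
  have h1 : max 0 r = r := max_eq_right hr.le
  have h2 : max 0 (-r) = 0 := max_eq_left hv.le
  have h3 : s • (w - r • y) = r • s • (r⁻¹ • w - y) := by
    rw [smul_comm r s, smul_sub r, smul_inv_smul₀ hr.ne']
  simp only [collapse, bumpVec, neg_neg, h1, h2, h3]
  generalize s • (r⁻¹ • w - y) = z
  rw [norm_smul, Real.norm_of_nonneg hr.le, Prod.smul_mk]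
  have h4 : r - r * ‖z‖ = r * (1 - ‖z‖) := by ring
  have h5 : max 0 (r * (1 - ‖z‖)) = r * max 0 (1 - ‖z‖) := by
    rw [mul_max_of_nonneg _ _ hr.le, mul_zero]
  rw [h4, h5, smul_smul, smul_smul]
  congr 1
  · simp only [smul_eq_mul]
    ring
  · congr 1
    ring

lemma collapse_ne_zero {s : ℝ} (hs : 0 < s) {y : Fin 3 → ℝ} {v : ReVec} (hv : v ≠ 0) :
    collapse s y v ≠ 0 := by
  rcases lt_or_ge v.1 0 with h | h
  · rw [collapse_of_neg s y h]
    exact smul_ne_zero (pow_ne_zero _ (by linarith)) (bumpVec_ne_zero _)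
  · intro h0
    have h1 : max 0 (-v.1) = 0 := max_eq_left (by linarith)
    have := (collapse_pos hs hv (by rw [h1]; exact norm_nonneg _) (y := y)).1
    rw [h0] at this
    exact lt_irrefl _ this

lemma normalize_collapse_of_neg (s : ℝ) (y : Fin 3 → ℝ) {v : ReVec} (hv : v.1 < 0) :
    normalize (collapse s y v) = bump (s • ((-v.1)⁻¹ • v.2 - y)) := by
  rw [collapse_of_neg s y hv, normalize_smul (pow_pos (by linarith) 2), bump]

lemma segment_collapse_ne_zero {v : ReVec} (hv : v ≠ 0) {t : ℝ} (h0 : 0 ≤ t) (h1 : t ≤ 1) :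
    (1 - t) • v + t • collapse 1 0 v ≠ 0 := by
  intro h
  have ha : (1 - t) * v.1 + t * (collapse 1 0 v).1 = 0 := congrArg Prod.fst h
  have hw : (1 - t) • v.2 + t • (collapse 1 0 v).2 = 0 := congrArg Prod.snd h
  by_cases hv2 : v.2 = 0
  · have hv1 : v.1 ≠ 0 := fun h1 => hv (Prod.ext h1 hv2)
    simp only [collapse, hv2, smul_zero, sub_zero, norm_zero] at ha
    rcases lt_or_gt_of_ne hv1 with h3 | h3
    · rw [max_eq_left h3.le, max_eq_right (by linarith : 0 ≤ -v.1)] at ha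
      rcases h0.eq_or_lt with h4 | h4
      · subst h4
        linarith
      · nlinarith [mul_pos h4 (mul_pos_of_neg_of_neg h3 h3)]
    · rw [max_eq_right h3.le, max_eq_left (by linarith : -v.1 ≤ 0)] at ha
      nlinarith
  · simp only [collapse, smul_zero, sub_zero, one_smul] at hw
    rw [smul_smul, ← add_smul, smul_eq_zero] at hw
    have h3 := hw.resolve_right hv2
    have h4 := le_max_left 0 (max 0 (-v.1) - ‖v.2‖)
    have h5 : t = 1 := by
      have := mul_nonneg h0 h4
      linarith
    subst h5
    refine collapse_ne_zero one_pos hv (y := 0) ?_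
    simpa using h

/-- The loop obtained by collapsing and normalizing a family of nonzero vectors. -/
def collapseLoop (s : ℝ) (hs : 0 < s) (y : Fin 3 → ℝ) (P : C(Fin 3 → I, ReVec)) (hP : ∀ x, P x ≠ 0)
    (hb : ∀ x ∈ Cube.boundary (Fin 3), 0 < (P x).1) : GenLoop (Fin 3) UnitQuat 1 :=
  ⟨⟨fun x => normalize (collapse s y (P x)), continuousOn_normalize.comp_continuous
      (continuous_collapse.comp (by fun_prop : Continuous fun x => (s, y, P x)))
      fun x => collapse_ne_zero hs (hP x)⟩,
    fun x hx => normalize_eq_one (collapse_pos_of_pos hs (hb x hx)).1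
      (collapse_pos_of_pos hs (hb x hx)).2⟩

lemma UnitQuat.coords_of_mem_boundary {N : Type*} (f : GenLoop N UnitQuat 1) {x : N → I}
    (hx : x ∈ Cube.boundary N) : coords (f x) = (1, 0) := by
  have : f x = 1 := f.2 x hx
  rw [this, coords_one]

lemma mk_eq_mk_collapseLoop (f : GenLoop (Fin 3) UnitQuat 1) (s : ℝ) (hs : 0 < s) (y : Fin 3 → ℝ)
    (P : C(Fin 3 → I, ReVec)) (hP : ∀ x, P x ≠ 0) (hb : ∀ x ∈ Cube.boundary (Fin 3), 0 < (P x).1)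
    (hf : ∀ x, ‖P x - coords (f x)‖ < 1 / 4) :
    HomotopyGroup.mk f = HomotopyGroup.mk (collapseLoop s hs y P hP hb) := by
  have hfc : Continuous fun x => coords (f x) := continuous_coords.comp f.1.continuous
  let V : C(Fin 3 → I, ReVec) := ⟨fun x => coords (f x), hfc⟩
  have hVb : ∀ x ∈ Cube.boundary (Fin 3), V x = (1, 0) := fun x hx => coords_of_mem_boundary f hx
  have hV1 : ∀ x ∈ Cube.boundary (Fin 3), 0 < (V x).1 := fun x hx => by simp [hVb x hx]
  trans HomotopyGroup.mk (collapseLoop 1 one_pos 0 V (fun x => coords_ne_zero _) hV1)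
  · refine HomotopyGroup.mk_eq_mk_iff.2 <| homotopic_of_normalize
      (fun z => (1 - (z.1 : ℝ)) • V z.2 + (z.1 : ℝ) • collapse 1 0 (V z.2)) ?_ ?_ ?_ ?_ ?_
    · have := continuous_collapse.comp
        (by fun_prop : Continuous fun z : I × (Fin 3 → I) => ((1 : ℝ), (0 : Fin 3 → ℝ), V z.2))
      have h2 : Continuous fun z : I × (Fin 3 → I) => collapse 1 0 (V z.2) := this
      fun_prop
    · exact fun z => segment_collapse_ne_zero (coords_ne_zero _) z.1.2.1 z.1.2.2
    · intro t x hx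
      have : collapse 1 0 (1, 0) = (1, 0) := by simp [collapse]
      simp [hVb x hx, this]
    · intro x
      simp [V]
    · intro x
      simp [V, collapseLoop]
  · refine HomotopyGroup.mk_eq_mk_iff.2 <| homotopic_of_normalize
      (fun z => collapse ((1 - (z.1 : ℝ)) + z.1 * s) ((z.1 : ℝ) • y)
        ((1 - (z.1 : ℝ)) • V z.2 + (z.1 : ℝ) • P z.2)) ?_ ?_ ?_ ?_ ?_
    · exact continuous_collapse.comp
        (by fun_prop : Continuous fun z : I × (Fin 3 → I) => ((1 - (z.1 : ℝ)) + z.1 * s,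
          (z.1 : ℝ) • y, (1 - (z.1 : ℝ)) • V z.2 + (z.1 : ℝ) • P z.2))
    · rintro ⟨t, x⟩
      have h0 := t.2.1
      have h1 := t.2.2
      refine collapse_ne_zero ?_ ?_
      · simp only
        rcases h0.eq_or_lt with h | h
        · rw [← h]
          norm_num
        · nlinarith
      · intro h
        have h2 : V x = -((t : ℝ) • (P x - V x)) := by
          rw [← sub_eq_zero, ← h]
          simp only [smul_sub, sub_smul, one_smul]
          abel
        have h3 := half_le_norm_coords (f x)
        change 1 / 2 ≤ ‖V x‖ at h3
        rw [h2, norm_neg, norm_smul, Real.norm_of_nonneg h0] at h3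
        have h4 : ‖P x - V x‖ < 1 / 4 := hf x
        nlinarith [norm_nonneg (P x - V x)]
    · intro t x hx
      have h0 := t.2.1
      have h1 := t.2.2
      refine collapse_pos_of_pos ?_ ?_
      · simp only
        rcases h0.eq_or_lt with h | h
        · rw [← h]
          norm_num
        · nlinarith
      · simp only [hVb x hx, Prod.fst_add, Prod.smul_fst, smul_eq_mul]
        rcases h0.eq_or_lt with h | h
        · rw [← h]
          norm_num
        · nlinarith [hb x hx]
    · intro x
      simp [collapseLoop]
      rfl
    · intro x
      simp [collapseLoop]
      rfl

lemma Matrix.exists_pos_mul_norm_le (A : Matrix (Fin 3) (Fin 3) ℝ) (hA : A.det ≠ 0) :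
    ∃ m > 0, ∀ w, m * ‖w‖ ≤ ‖A *ᵥ w‖ := by
  let B : (Fin 3 → ℝ) →L[ℝ] (Fin 3 → ℝ) := LinearMap.toContinuousLinearMap (Matrix.toLin' A⁻¹)
  refine ⟨(‖B‖ + 1)⁻¹, by positivity, fun w => ?_⟩
  have h1 : B (A *ᵥ w) = w := by
    change A⁻¹ *ᵥ (A *ᵥ w) = w
    rw [mulVec_mulVec, nonsing_inv_mul _ (isUnit_iff_ne_zero.2 hA), one_mulVec]
  have h2 := B.le_opNorm (A *ᵥ w)
  rw [h1] at h2
  rw [inv_mul_le_iff₀ (by positivity)]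
  nlinarith [norm_nonneg (A *ᵥ w)]

/-- A loop that near a point `p` is a bump along a map with invertible linear approximation can be
cut off outside a ball around `p`, and the result is a power of the standard bump loop. -/
lemma exists_localLoop (G : GenLoop (Fin 3) UnitQuat 1) {p : Fin 3 → ℝ} {r s m : ℝ}
    {k : (Fin 3 → ℝ) → Fin 3 → ℝ} {A : Matrix (Fin 3) (Fin 3) ℝ}
    (hG : ∀ x, ‖cubeVal x - p‖ ≤ r → G x = bump (s • k (cubeVal x)))
    (hk : ContinuousOn k (Metric.closedBall p r))
    (hA : ∀ w, m * ‖w‖ ≤ ‖A *ᵥ w‖)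
    (hkA : ∀ x ∈ Metric.closedBall p r, ‖k x - A *ᵥ (x - p)‖ ≤ m / 2 * ‖x - p‖)
    (hdet : A.det ≠ 0) (hs : 0 < s) (hm : 0 < m) (hr : 0 < r) (hsmr : 1 ≤ s * (m / 2 * r))
    (hp : ‖p - cubeCenter‖ + r < 1 / 2) :
    ∃ g : GenLoop (Fin 3) UnitQuat 1,
      HomotopyGroup.mk g ∈ Subgroup.zpowers (HomotopyGroup.mk (signLoop ∅)) ∧
      ∀ x, g x = if ‖cubeVal x - p‖ ≤ r then G x else 1 := by
  have hfar : ∀ x ∈ Cube.boundary (Fin 3), r < ‖cubeVal x - p‖ := by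
    intro x hx
    have h1 := norm_cubeVal_sub_center hx
    have h2 := norm_add_le (cubeVal x - p) (p - cubeCenter)
    rw [sub_add_sub_cancel, h1] at h2
    linarith
  have hball : ∀ x, ‖cubeVal x - p‖ ≤ r → cubeVal x ∈ Metric.closedBall p r := fun x hx => by
    rwa [Metric.mem_closedBall, dist_eq_norm]
  let J : I × (Fin 3 → I) → Fin 3 → ℝ := fun z => (1 - (z.1 : ℝ)) • k (cubeVal z.2) +
    (z.1 : ℝ) • (A *ᵥ (cubeVal z.2 - p))
  have hJ (z : I × (Fin 3 → I)) (hz : ‖cubeVal z.2 - p‖ = r) : bump (s • J z) = 1 := by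
    apply bump_eq_one
    rw [norm_smul, Real.norm_of_nonneg hs.le]
    have h1 : J z = A *ᵥ (cubeVal z.2 - p) -
        (-((1 - (z.1 : ℝ)) • (k (cubeVal z.2) - A *ᵥ (cubeVal z.2 - p)))) := by
      simp only [J, smul_sub, sub_smul, one_smul]
      abel
    have h2 := norm_sub_norm_le (A *ᵥ (cubeVal z.2 - p))
      (-((1 - (z.1 : ℝ)) • (k (cubeVal z.2) - A *ᵥ (cubeVal z.2 - p))))
    have h5 : 0 ≤ 1 - (z.1 : ℝ) := by linarith [z.1.2.2]
    rw [← h1, norm_neg, norm_smul, Real.norm_of_nonneg h5] at h2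
    have h3 := hkA _ (hball z.2 hz.le)
    have h4 := hA (cubeVal z.2 - p)
    rw [hz] at h3 h4
    have h6 : m / 2 * r ≤ ‖J z‖ := by
      have := z.1.2.1
      nlinarith [norm_nonneg (k (cubeVal z.2) - A *ᵥ (cubeVal z.2 - p))]
    exact hsmr.trans (mul_le_mul_of_nonneg_left h6 hs.le)
  let F : I × (Fin 3 → I) → UnitQuat := fun z =>
    if ‖cubeVal z.2 - p‖ ≤ r then bump (s • J z) else 1
  have hF : Continuous F := by
    refine continuous_if_le (by fun_prop) continuous_const ?_ continuousOn_const hJ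
    have h1 : ContinuousOn (fun z : I × (Fin 3 → I) => k (cubeVal z.2))
        {z | ‖cubeVal z.2 - p‖ ≤ r} :=
      hk.comp (continuous_cubeVal.comp continuous_snd).continuousOn fun z hz => hball z.2 hz
    have h2 : ContinuousOn J {z | ‖cubeVal z.2 - p‖ ≤ r} :=
      ((by fun_prop : Continuous fun z : I × (Fin 3 → I) => 1 - (z.1 : ℝ)).continuousOn.smul h1).add
        (by fun_prop : Continuous fun z : I × (Fin 3 → I) =>
          (z.1 : ℝ) • (A *ᵥ (cubeVal z.2 - p))).continuousOn
    exact continuous_bump.comp_continuousOn (h2.const_smul s)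
  have hF0 (t : I) (x : Fin 3 → I) (hx : x ∈ Cube.boundary (Fin 3)) : F (t, x) = 1 :=
    if_neg (hfar x hx).not_ge
  let g : GenLoop (Fin 3) UnitQuat 1 :=
    ⟨⟨fun x => F (0, x), by fun_prop⟩, fun x hx => hF0 0 x hx⟩
  refine ⟨g, ?_, fun x => ?_⟩
  · have hbd : ∀ x, r < ‖cubeVal x - p‖ → 1 ≤ ‖cubeAffine (s • A) p x‖ := by
      intro x hx
      change 1 ≤ ‖(s • A) *ᵥ (cubeVal x - p)‖
      rw [smul_mulVec, norm_smul, Real.norm_of_nonneg hs.le]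
      refine hsmr.trans (mul_le_mul_of_nonneg_left ?_ hs.le)
      refine le_trans ?_ (hA _)
      nlinarith
    have hdet' : (s • A).det ≠ 0 := by
      rw [det_smul]
      exact mul_ne_zero (pow_ne_zero _ hs.ne') hdet
    have : HomotopyGroup.mk g = HomotopyGroup.mk
        (bumpLoop (cubeAffine (s • A) p) fun x hx => hbd x (hfar x hx)) := by
      refine HomotopyGroup.mk_eq_mk_iff.2
        ⟨⟨⟨⟨F, hF⟩, fun x => rfl, fun x => ?_⟩, fun t x hx => ?_⟩⟩
      · change F (1, x) = bump ((s • A) *ᵥ (cubeVal x - p))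
        by_cases hx : ‖cubeVal x - p‖ ≤ r
        · simp only [F, hx, if_true, J]
          simp [smul_mulVec]
        · simp only [F, hx, if_false]
          exact (bump_eq_one (hbd x (not_le.1 hx))).symm
      · exact (hF0 t x hx).trans (hF0 0 x hx).symm
    rw [this]
    exact bumpLoop_cubeAffine_mem_zpowers _ hdet' p (by linarith) _
  · change F (0, x) = _
    simp only [F]
    split_ifs with hx
    · rw [hG x hx]
      simp [J]
    · rfl

/-- If a loop is trivial outside finitely many disjoint balls and each of its restrictions to those
balls has class in a subgroup, so has the whole loop. -/
lemma mk_mem_of_localLoops (G : GenLoop (Fin 3) UnitQuat 1) (T : Finset (Fin 3 → ℝ)) {r : ℝ}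
    (hdisj : ∀ p ∈ T, ∀ q ∈ T, p ≠ q → r + r < ‖p - q‖)
    (hout : ∀ x, (∀ p ∈ T, r < ‖cubeVal x - p‖) → G x = 1)
    (S : Subgroup (HomotopyGroup (Fin 3) UnitQuat 1))
    (hloc : ∀ p ∈ T, ∃ g : GenLoop (Fin 3) UnitQuat 1, HomotopyGroup.mk g ∈ S ∧
      ∀ x, g x = if ‖cubeVal x - p‖ ≤ r then G x else 1) :
    HomotopyGroup.mk G ∈ S := by
  classical
  have key : ∀ T' ⊆ T, ∃ g : GenLoop (Fin 3) UnitQuat 1, HomotopyGroup.mk g ∈ S ∧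
      ∀ x, g x = if ∃ p ∈ T', ‖cubeVal x - p‖ ≤ r then G x else 1 := by
    intro T'
    induction T' using Finset.induction_on with
    | empty =>
      intro _
      exact ⟨GenLoop.const, S.one_mem, fun x => by simp⟩
    | insert p T' hp ih =>
      intro hT
      obtain ⟨g, hg, hgx⟩ := ih ((Finset.subset_insert p T').trans hT)
      obtain ⟨h, hh, hhx⟩ := hloc p (hT (Finset.mem_insert_self p T'))
      refine ⟨GenLoop.pointwiseMul h g, ?_, fun x => ?_⟩
      · rw [HomotopyGroup.mk_pointwiseMul]
        exact S.mul_mem hg hh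
      · change h x * g x = _
        rw [hgx, hhx]
        by_cases h1 : ‖cubeVal x - p‖ ≤ r
        · have h2 : ¬ ∃ q ∈ T', ‖cubeVal x - q‖ ≤ r := by
            rintro ⟨q, hq, hqx⟩
            have h3 := hdisj p (hT (Finset.mem_insert_self p T')) q
              (hT (Finset.mem_insert_of_mem hq)) (fun h => hp (h ▸ hq))
            have h4 := norm_sub_le_norm_sub_add_norm_sub p (cubeVal x) q
            rw [norm_sub_rev p (cubeVal x)] at h4
            linarith
          have h3 : ∃ q ∈ insert p T', ‖cubeVal x - q‖ ≤ r :=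
            ⟨p, Finset.mem_insert_self p T', h1⟩
          rw [if_pos h1, if_neg h2, if_pos h3, mul_one]
        · have h2 : (∃ q ∈ insert p T', ‖cubeVal x - q‖ ≤ r) ↔ ∃ q ∈ T', ‖cubeVal x - q‖ ≤ r := by
            simp [h1]
          rw [if_neg h1, one_mul]
          simp only [h2]
  obtain ⟨g, hg, hgx⟩ := key T subset_rfl
  have : g = G := by
    ext1 x
    rw [hgx]
    split_ifs with h
    · rfl
    · push Not at h
      exact (hout x h).symm
  rwa [← this]

lemma norm_cubeVal_sub_center_lt {x : Fin 3 → I} (hx : x ∉ Cube.boundary (Fin 3)) :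
    ‖cubeVal x - cubeCenter‖ < 1 / 2 := by
  rw [pi_norm_lt_iff (by norm_num)]
  intro i
  have h0 : x i ≠ 0 := fun h => hx ⟨i, Or.inl h⟩
  have h1 : x i ≠ 1 := fun h => hx ⟨i, Or.inr h⟩
  have h2 := unitInterval.pos_iff_ne_zero.2 h0
  have h3 := unitInterval.lt_one_iff_ne_one.2 h1
  have h4 : 0 < (x i : ℝ) := h2
  have h5 : (x i : ℝ) < 1 := h3
  rw [Real.norm_eq_abs, abs_lt]
  simp only [cubeVal, cubeCenter, Pi.sub_apply]
  constructor <;> linarith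

/-- Sard for maps from three-space to itself: a regular value exists. -/
lemma exists_regular_value (k : (Fin 3 → ℝ) → Fin 3 → ℝ) (U : Set (Fin 3 → ℝ))
    (hk : ∀ x ∈ U, DifferentiableAt ℝ k x) :
    ∃ y, ∀ x ∈ U, k x = y → (fderiv ℝ k x).det ≠ 0 := by
  by_contra! h
  have h1 : k '' {x ∈ U | (fderiv ℝ k x).det = 0} = Set.univ := by
    rw [Set.eq_univ_iff_forall]
    intro y
    obtain ⟨x, hx, hxy, hd⟩ := h y
    exact ⟨x, ⟨hx, hd⟩, hxy⟩
  have h2 := MeasureTheory.addHaar_image_eq_zero_of_det_fderivWithin_eq_zero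
    (MeasureTheory.volume : MeasureTheory.Measure (Fin 3 → ℝ)) (f := k) (f' := fderiv ℝ k)
    (s := {x ∈ U | (fderiv ℝ k x).det = 0})
    (fun x hx => (hk x hx.1).hasFDerivAt.hasFDerivWithinAt) (fun x hx => hx.2)
  rw [h1] at h2
  simp at h2

/-- The third homotopy group of the unit quaternions is generated by the standard bump loop. -/
theorem mem_zpowers_signLoop (a : HomotopyGroup (Fin 3) UnitQuat 1) :
    a ∈ Subgroup.zpowers (HomotopyGroup.mk (signLoop ∅)) := by
  obtain ⟨f, rfl⟩ := HomotopyGroup.mk_surjective a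
  obtain ⟨P, hP, hPf⟩ := exists_contDiff_near
    ⟨fun x => coords (f x), continuous_coords.comp f.1.continuous⟩ (by norm_num : (0 : ℝ) < 1 / 4)
  simp only [ContinuousMap.coe_mk] at hPf
  have hPc : Continuous P := hP.continuous
  have hP0 : ∀ x : Fin 3 → I, P (cubeVal x) ≠ 0 := by
    intro x hx
    have h1 := hPf x
    have h2 := half_le_norm_coords (f x)
    rw [hx, zero_sub, norm_neg] at h1
    linarith
  have hPb : ∀ x ∈ Cube.boundary (Fin 3), 0 < (P (cubeVal x)).1 := by
    intro x hx
    have h1 := hPf x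
    rw [coords_of_mem_boundary f hx] at h1
    have h2 := (norm_fst_le _).trans_lt h1
    simp only [Prod.fst_sub, Real.norm_eq_abs, abs_lt] at h2
    linarith
  let k : (Fin 3 → ℝ) → Fin 3 → ℝ := fun x => (-(P x).1)⁻¹ • (P x).2
  have hk : ∀ x, (P x).1 < 0 → DifferentiableAt ℝ k x := by
    intro x hx
    have hd : DifferentiableAt ℝ P x := hP.differentiable (by simp) x
    have h1 : -(P x).1 ≠ 0 := by linarith
    exact (hd.fst.neg.inv h1).smul hd.snd
  obtain ⟨y, hy⟩ := exists_regular_value k {x | (P x).1 < 0} hk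
  let Tz : Set (Fin 3 → I) :=
    {z | (P (cubeVal z)).1 ≤ 0 ∧ (P (cubeVal z)).2 = -(P (cubeVal z)).1 • y}
  have hPv : Continuous fun z : Fin 3 → I => P (cubeVal z) := by fun_prop
  have hTz : IsClosed Tz := IsClosed.inter (isClosed_le hPv.fst continuous_const)
    (isClosed_eq hPv.snd (hPv.fst.neg.smul continuous_const))
  have hTneg : ∀ z ∈ Tz, (P (cubeVal z)).1 < 0 := by
    rintro z ⟨h1, h2⟩
    refine lt_of_le_of_ne h1 fun h3 => hP0 z (Prod.ext h3 ?_)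
    rw [h2, h3]
    simp
  let TR : Set (Fin 3 → ℝ) := cubeVal '' Tz
  have hTR : IsCompact TR := hTz.isCompact.image continuous_cubeVal
  have hTRneg : ∀ p ∈ TR, (P p).1 < 0 := by
    rintro _ ⟨z, hz, rfl⟩
    exact hTneg z hz
  have hTRk : ∀ p ∈ TR, k p = y := by
    rintro _ ⟨z, hz, rfl⟩
    have h1 := hTneg z hz
    simp only [k]
    rw [hz.2, inv_smul_smul₀ (by linarith)]
  have hTRc : ∀ p ∈ TR, ‖p - cubeCenter‖ < 1 / 2 := by
    rintro _ ⟨z, hz, rfl⟩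
    refine norm_cubeVal_sub_center_lt fun hb => ?_
    exact (hPb z hb).not_gt (hTneg z hz)
  let A : (Fin 3 → ℝ) → Matrix (Fin 3) (Fin 3) ℝ := fun p =>
    LinearMap.toMatrix' (fderiv ℝ k p : (Fin 3 → ℝ) →ₗ[ℝ] (Fin 3 → ℝ))
  have hAmul (p w : Fin 3 → ℝ) : A p *ᵥ w = fderiv ℝ k p w := LinearMap.toMatrix'_mulVec _ _
  have hAdet : ∀ p ∈ TR, (A p).det ≠ 0 := by
    intro p hp
    rw [LinearMap.det_toMatrix']
    exact hy p (hTRneg p hp) (hTRk p hp)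
  have hmex : ∀ p, ∃ m > 0, p ∈ TR → ∀ w, m * ‖w‖ ≤ ‖A p *ᵥ w‖ := by
    intro p
    by_cases hp : p ∈ TR
    · obtain ⟨m, hm, h⟩ := (A p).exists_pos_mul_norm_le (hAdet p hp)
      exact ⟨m, hm, fun _ => h⟩
    · exact ⟨1, one_pos, fun h => absurd h hp⟩
  choose m hm hmA using hmex
  have hfin : TR.Finite := by
    by_contra hinf
    obtain ⟨p, hp, hacc⟩ :=
      Set.Infinite.exists_accPt_of_subset_isCompact hinf hTR subset_rfl
    have hanti : ∃ C, AntilipschitzWith C (fderiv ℝ k p) := by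
      refine ⟨Real.toNNReal (m p)⁻¹, ?_⟩
      refine AddMonoidHomClass.antilipschitz_of_bound _ fun x => ?_
      have h1 := hmA p hp x
      rw [hAmul] at h1
      rw [Real.coe_toNNReal _ (inv_pos.2 (hm p)).le, inv_mul_eq_div, le_div_iff₀ (hm p)]
      linarith
    have h1 := (hk p (hTRneg p hp)).hasFDerivAt.eventually_ne (c := y) hanti
    rw [accPt_iff_frequently_nhdsNE] at hacc
    exact hacc (h1.mono fun z hz hzT => hz (hTRk z hzT))
  let T := hfin.toFinset
  have hT : ∀ {p}, p ∈ T ↔ p ∈ TR := hfin.mem_toFinset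
  obtain ⟨r, hr0, hr⟩ : ∃ r > 0, ∀ p ∈ T,
      (∀ x ∈ Metric.closedBall p r, (P x).1 < 0 ∧
        ‖k x - k p - fderiv ℝ k p (x - p)‖ ≤ m p / 2 * ‖x - p‖) ∧
      ‖p - cubeCenter‖ + r < 1 / 2 ∧ ∀ q ∈ T, p ≠ q → r + r < ‖p - q‖ := by
    have h1 : ∀ᶠ r in 𝓝[>] (0 : ℝ), ∀ p ∈ T,
      (∀ x ∈ Metric.closedBall p r, (P x).1 < 0 ∧
        ‖k x - k p - fderiv ℝ k p (x - p)‖ ≤ m p / 2 * ‖x - p‖) ∧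
      ‖p - cubeCenter‖ + r < 1 / 2 ∧ ∀ q ∈ T, p ≠ q → r + r < ‖p - q‖ := by
      refine Filter.Eventually.filter_mono nhdsWithin_le_nhds ?_
      refine (Filter.eventually_all_finset T).2 fun p hp => ?_
      have hpR := hT.1 hp
      have e1 : ∀ᶠ x in 𝓝 p, (P x).1 < 0 ∧
          ‖k x - k p - fderiv ℝ k p (x - p)‖ ≤ m p / 2 * ‖x - p‖ :=
        (hPc.fst.continuousAt.eventually_lt continuousAt_const (hTRneg p hpR)).and
          ((hk p (hTRneg p hpR)).hasFDerivAt.isLittleO.def (half_pos (hm p)))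
      have e2 : ∀ᶠ r in 𝓝 (0 : ℝ), ‖p - cubeCenter‖ + r < 1 / 2 := by
        refine ContinuousAt.eventually_lt (by fun_prop) continuousAt_const ?_
        simpa using hTRc p hpR
      have e3 : ∀ᶠ r in 𝓝 (0 : ℝ), ∀ q ∈ T, p ≠ q → r + r < ‖p - q‖ := by
        refine (Filter.eventually_all_finset T).2 fun q _ => ?_
        by_cases hpq : p = q
        · exact Filter.Eventually.of_forall fun r h => absurd hpq h
        · have : ∀ᶠ r in 𝓝 (0 : ℝ), r + r < ‖p - q‖ := by
            refine ContinuousAt.eventually_lt (by fun_prop) continuousAt_const ?_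
            simpa using sub_ne_zero.2 hpq
          exact this.mono fun r h _ => h
      filter_upwards [eventually_closedBall_subset e1, e2, e3] with r h1 h2 h3
      exact ⟨h1, h2, h3⟩
    obtain ⟨r, hr, hr0⟩ := (h1.and self_mem_nhdsWithin).exists
    exact ⟨r, hr0, hr⟩
  let PC : C(Fin 3 → I, ReVec) := ⟨fun x => P (cubeVal x), by fun_prop⟩
  obtain ⟨s, hs0, hs1, hs2⟩ : ∃ s > 0, (∀ p ∈ T, 1 ≤ s * (m p / 2 * r)) ∧
      ∀ x, (∀ p ∈ T, r < ‖cubeVal x - p‖) →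
        max 0 (-(PC x).1) ≤ ‖s • ((PC x).2 - max 0 (-(PC x).1) • y)‖ := by
    let g : (Fin 3 → I) → ℝ := fun x => ‖(PC x).2 - max 0 (-(PC x).1) • y‖
    have hg : Continuous g := by fun_prop
    have hC : IsClosed {x | (∀ p ∈ T, r ≤ ‖cubeVal x - p‖) ∧ (PC x).1 ≤ 0} := by
      have h1 : {x | (∀ p ∈ T, r ≤ ‖cubeVal x - p‖) ∧ (PC x).1 ≤ 0} =
          (⋂ p ∈ T, {x | r ≤ ‖cubeVal x - p‖}) ∩ {x | (PC x).1 ≤ 0} := by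
        ext x
        simp
      rw [h1]
      exact (isClosed_biInter fun p _ => isClosed_le continuous_const (by fun_prop)).inter
        (isClosed_le PC.continuous.fst continuous_const)
    obtain ⟨μ, hμ, hgμ⟩ := hC.isCompact.exists_forall_le' hg.continuousOn (a := 0) (by
      rintro x ⟨hx1, hx2⟩
      refine norm_pos_iff.2 fun h0 => ?_
      rw [max_eq_right (by linarith : 0 ≤ -(PC x).1), sub_eq_zero] at h0
      have hxT : x ∈ Tz := ⟨hx2, h0⟩
      have := hx1 (cubeVal x) (hT.2 ⟨x, hxT, rfl⟩)
      rw [sub_self, norm_zero] at this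
      linarith)
    obtain ⟨R, hR⟩ := isCompact_univ.exists_bound_of_continuousOn
      (f := fun x => max 0 (-(PC x).1)) (by fun_prop)
    have h1 : ∀ᶠ s in Filter.atTop, ∀ p ∈ T, 1 ≤ s * (m p / 2 * r) := by
      refine (Filter.eventually_all_finset T).2 fun p _ => ?_
      exact (Filter.tendsto_id.atTop_mul_const
        (mul_pos (half_pos (hm p)) hr0)).eventually_ge_atTop 1
    obtain ⟨s, hs1, hs0, hs2⟩ := (h1.and ((Filter.eventually_gt_atTop 0).and
      (Filter.eventually_ge_atTop (R / μ)))).exists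
    refine ⟨s, hs0, hs1, fun x hx => ?_⟩
    rcases le_or_gt (PC x).1 0 with h | h
    · rw [norm_smul, Real.norm_of_nonneg hs0.le]
      have h2 := hgμ x ⟨fun p hp => (hx p hp).le, h⟩
      have h3 := (le_abs_self _).trans (hR x trivial)
      rw [div_le_iff₀ hμ] at hs2
      exact h3.trans (hs2.trans (mul_le_mul_of_nonneg_left h2 hs0.le))
    · rw [max_eq_left (by linarith)]
      exact norm_nonneg _
  have hmk := mk_eq_mk_collapseLoop f s hs0 y PC hP0 hPb hPf
  rw [hmk]
  have hval (x) : collapseLoop s hs0 y PC hP0 hPb x = normalize (collapse s y (PC x)) := rfl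
  refine mk_mem_of_localLoops _ T (r := r) (fun p hp => (hr p hp).2.2) ?_ _ ?_
  · intro x hx
    have h1 := collapse_pos hs0 (hP0 x) (hs2 x hx)
    rw [hval]
    exact normalize_eq_one h1.1 h1.2
  · intro p hp
    have hpR := hT.1 hp
    obtain ⟨hr1, hr2, -⟩ := hr p hp
    refine exists_localLoop _ (k := fun x => k x - y) (A := A p) (s := s) (m := m p) ?_ ?_
      (hmA p hpR) ?_ (hAdet p hpR) hs0 (hm p) hr0 (hs1 p hp) hr2
    · intro x hx
      rw [hval, normalize_collapse_of_neg]
      · rfl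
      · exact (hr1 (cubeVal x) (by rwa [Metric.mem_closedBall, dist_eq_norm])).1
    · exact fun x hx => ((hk x (hr1 x hx).1).continuousAt.sub continuousAt_const).continuousWithinAt
    · intro x hx
      rw [hAmul, ← hTRk p hpR]
      exact (hr1 x hx).2

/-- The determinant of three vectors in three-space. -/
def det3 (b c d : Fin 3 → ℝ) : ℝ :=
  b 0 * (c 1 * d 2 - c 2 * d 1) - b 1 * (c 0 * d 2 - c 2 * d 0) + b 2 * (c 0 * d 1 - c 1 * d 0)

/-- The determinant of four vectors in four-space. -/
def det4 (u v w z : ReVec) : ℝ :=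
  u.1 * det3 v.2 w.2 z.2 - v.1 * det3 u.2 w.2 z.2 + w.1 * det3 u.2 v.2 z.2 - z.1 * det3 u.2 v.2 w.2

lemma HasDerivAt.det3 {b c d : ℝ → Fin 3 → ℝ} {b' c' d' : Fin 3 → ℝ} {t : ℝ}
    (hb : HasDerivAt b b' t) (hc : HasDerivAt c c' t) (hd : HasDerivAt d d' t) :
    HasDerivAt (fun t => _root_.det3 (b t) (c t) (d t))
      (_root_.det3 b' (c t) (d t) + _root_.det3 (b t) c' (d t) + _root_.det3 (b t) (c t) d') t := by
  rw [hasDerivAt_pi] at hb hc hd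
  refine HasDerivAt.congr_deriv
    ((((hb 0).mul (((hc 1).mul (hd 2)).sub ((hc 2).mul (hd 1)))).sub
      ((hb 1).mul (((hc 0).mul (hd 2)).sub ((hc 2).mul (hd 0))))).add
      ((hb 2).mul (((hc 0).mul (hd 1)).sub ((hc 1).mul (hd 0))))) ?_
  simp only [_root_.det3, Pi.sub_apply, Pi.mul_apply]
  ring

lemma HasDerivAt.fst_reVec {u : ℝ → ReVec} {u' : ReVec} {t : ℝ} (hu : HasDerivAt u u' t) :
    HasDerivAt (fun t => (u t).1) u'.1 t :=
  (ContinuousLinearMap.fst ℝ ℝ (Fin 3 → ℝ)).hasFDerivAt.comp_hasDerivAt t hu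

lemma HasDerivAt.snd_reVec {u : ℝ → ReVec} {u' : ReVec} {t : ℝ} (hu : HasDerivAt u u' t) :
    HasDerivAt (fun t => (u t).2) u'.2 t :=
  (ContinuousLinearMap.snd ℝ ℝ (Fin 3 → ℝ)).hasFDerivAt.comp_hasDerivAt t hu

lemma HasDerivAt.det4 {u v w z : ℝ → ReVec} {u' v' w' z' : ReVec} {t : ℝ}
    (hu : HasDerivAt u u' t) (hv : HasDerivAt v v' t) (hw : HasDerivAt w w' t)
    (hz : HasDerivAt z z' t) :
    HasDerivAt (fun t => _root_.det4 (u t) (v t) (w t) (z t))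
      (_root_.det4 u' (v t) (w t) (z t) + _root_.det4 (u t) v' (w t) (z t) +
        _root_.det4 (u t) (v t) w' (z t) + _root_.det4 (u t) (v t) (w t) z') t := by
  refine HasDerivAt.congr_deriv
    ((((hu.fst_reVec.mul (hv.snd_reVec.det3 hw.snd_reVec hz.snd_reVec)).sub
      (hv.fst_reVec.mul (hu.snd_reVec.det3 hw.snd_reVec hz.snd_reVec))).add
      (hw.fst_reVec.mul (hu.snd_reVec.det3 hv.snd_reVec hz.snd_reVec))).sub
      (hz.fst_reVec.mul (hu.snd_reVec.det3 hv.snd_reVec hw.snd_reVec))) ?_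
  simp only [_root_.det4]
  ring

/-- The squared Euclidean length of a vector in four-space. -/
def lenSq (v : ReVec) : ℝ := v.1 ^ 2 + v.2 0 ^ 2 + v.2 1 ^ 2 + v.2 2 ^ 2

lemma lenSq_pos {v : ReVec} (hv : v ≠ 0) : 0 < lenSq v := by
  by_contra! h
  unfold lenSq at h
  refine hv (Prod.ext ?_ (funext fun i => ?_))
  · have : v.1 ^ 2 = 0 := by
      nlinarith [sq_nonneg v.1, sq_nonneg (v.2 0), sq_nonneg (v.2 1), sq_nonneg (v.2 2)]
    simpa using this
  · have h0 : v.2 0 ^ 2 = 0 := by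
      nlinarith [sq_nonneg v.1, sq_nonneg (v.2 0), sq_nonneg (v.2 1), sq_nonneg (v.2 2)]
    have h1 : v.2 1 ^ 2 = 0 := by
      nlinarith [sq_nonneg v.1, sq_nonneg (v.2 0), sq_nonneg (v.2 1), sq_nonneg (v.2 2)]
    have h2 : v.2 2 ^ 2 = 0 := by
      nlinarith [sq_nonneg v.1, sq_nonneg (v.2 0), sq_nonneg (v.2 1), sq_nonneg (v.2 2)]
    fin_cases i
    · simpa using h0
    · simpa using h1
    · simpa using h2

/-- A weight on four-space minus the origin, homogeneous of degree `-4`, positive on the half-space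
of negative real part and vanishing on the complementary half-space. -/
def weight (v : ReVec) : ℝ := max 0 (-v.1) ^ 2 * (lenSq v)⁻¹ ^ 3

/-- The differential of `weight` at `v` applied to `w`. -/
def weightDeriv (v w : ReVec) : ℝ :=
  -(2 * max 0 (-v.1) * w.1) * (lenSq v)⁻¹ ^ 3 - 6 * max 0 (-v.1) ^ 2 * (lenSq v)⁻¹ ^ 4 *
    (v.1 * w.1 + v.2 0 * w.2 0 + v.2 1 * w.2 1 + v.2 2 * w.2 2)

lemma weight_eq_zero {v : ReVec} (h : 0 ≤ v.1) : weight v = 0 := by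
  have : max 0 (-v.1) = 0 := max_eq_left (by linarith)
  simp [weight, this]

lemma weight_nonneg (v : ReVec) : 0 ≤ weight v := by
  have : 0 ≤ lenSq v := by unfold lenSq; positivity
  unfold weight
  positivity

lemma weightDeriv_self {v : ReVec} (hv : v ≠ 0) : weightDeriv v v = -4 * weight v := by
  have h := lenSq_pos hv
  have h1 : v.1 * v.1 + v.2 0 * v.2 0 + v.2 1 * v.2 1 + v.2 2 * v.2 2 = lenSq v := by
    unfold lenSq
    ring
  have h2 : max 0 (-v.1) * v.1 = -max 0 (-v.1) ^ 2 := by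
    rcases le_total 0 v.1 with h | h
    · rw [max_eq_left (by linarith)]
      simp
    · rw [max_eq_right (by linarith)]
      ring
  have h3 : (lenSq v)⁻¹ ^ 4 * lenSq v = (lenSq v)⁻¹ ^ 3 := by
    field_simp
  rw [weightDeriv, h1, weight]
  linear_combination -2 * (lenSq v)⁻¹ ^ 3 * h2 - 6 * max 0 (-v.1) ^ 2 * h3

lemma hasDerivAt_max_zero_sq (x : ℝ) : HasDerivAt (fun x : ℝ => max 0 x ^ 2) (2 * max 0 x) x := by
  rcases lt_trichotomy x 0 with h | rfl | h
  · rw [max_eq_left h.le, mul_zero]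
    refine (hasDerivAt_const x (0 : ℝ)).congr_of_eventuallyEq ?_
    filter_upwards [eventually_lt_nhds h] with y hy
    simp [max_eq_left hy.le]
  · simp only [max_self, mul_zero]
    rw [hasDerivAt_iff_isLittleO]
    simp only [max_self, sub_zero, smul_zero]
    have : (fun x : ℝ => max 0 x ^ 2 - 0 ^ 2) =O[𝓝 0] fun x : ℝ => x ^ 2 := by
      refine Asymptotics.IsBigO.of_bound 1 (Filter.Eventually.of_forall fun y => ?_)
      rw [one_mul, Real.norm_eq_abs, Real.norm_eq_abs, zero_pow two_ne_zero, sub_zero, abs_sq,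
        abs_sq, ← sq_abs y]
      exact pow_le_pow_left₀ (le_max_left _ _) (max_le (abs_nonneg y) (le_abs_self y)) 2
    exact this.trans_isLittleO (Asymptotics.isLittleO_pow_id one_lt_two)
  · rw [max_eq_right h.le]
    have h1 : HasDerivAt (fun x : ℝ => x ^ 2) (2 * x) x := by
      simpa using hasDerivAt_pow 2 x
    refine h1.congr_of_eventuallyEq ?_
    filter_upwards [eventually_gt_nhds h] with y hy
    simp [max_eq_right hy.le]

lemma HasDerivAt.weight {u : ℝ → ReVec} {u' : ReVec} {t : ℝ} (hu : HasDerivAt u u' t)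
    (h0 : u t ≠ 0) : HasDerivAt (fun t => _root_.weight (u t)) (weightDeriv (u t) u') t := by
  have h1 := (hasDerivAt_max_zero_sq (-(u t).1)).comp t hu.fst_reVec.neg
  have hc := hasDerivAt_pi.1 hu.snd_reVec
  have h2 : HasDerivAt (fun t => lenSq (u t)) (2 * ((u t).1 * u'.1 + (u t).2 0 * u'.2 0 +
      (u t).2 1 * u'.2 1 + (u t).2 2 * u'.2 2)) t := by
    refine HasDerivAt.congr_deriv ((((hu.fst_reVec.pow 2).add ((hc 0).pow 2)).add
      ((hc 1).pow 2)).add ((hc 2).pow 2)) ?_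
    simp
    ring
  refine (h1.mul ((h2.inv (lenSq_pos h0).ne').pow 3)).congr_deriv ?_
  simp only [Function.comp, weightDeriv, Pi.inv_apply, Pi.pow_apply, Pi.neg_apply, div_eq_mul_inv,
    inv_pow]
  generalize lenSq (u t) = q
  ring

lemma differentiableAt_weight {v : ReVec} (hv : v ≠ 0) : DifferentiableAt ℝ weight v := by
  have h1 : DifferentiableAt ℝ (fun v : ReVec => max 0 (-v.1) ^ 2) v :=
    (hasDerivAt_max_zero_sq (-v.1)).differentiableAt.comp v differentiableAt_fst.neg
  have h2 : DifferentiableAt ℝ lenSq v := by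
    unfold lenSq
    fun_prop
  exact h1.mul ((h2.inv (lenSq_pos hv).ne').pow 3)

/-- The terms of the divergence cancel. -/
lemma det4_divergence (k a b c d ab ac ad bc bd cd : ReVec) (hk : k ≠ 0) :
    (weightDeriv k a * det4 k b c d + weight k * (det4 a b c d + det4 k ab c d + det4 k b ac d +
      det4 k b c ad)) -
    (weightDeriv k b * det4 k a c d + weight k * (det4 b a c d + det4 k ab c d + det4 k a bc d +
      det4 k a c bd)) +
    (weightDeriv k c * det4 k a b d + weight k * (det4 c a b d + det4 k ac b d + det4 k a bc d +
      det4 k a b cd)) -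
    (weightDeriv k d * det4 k a b c + weight k * (det4 d a b c + det4 k ad b c + det4 k a bd c +
      det4 k a b cd)) = 0 := by
  have h1 : weightDeriv k a * det4 k b c d - weightDeriv k b * det4 k a c d +
      weightDeriv k c * det4 k a b d - weightDeriv k d * det4 k a b c =
      weightDeriv k k * det4 a b c d := by
    unfold weightDeriv det4 det3
    generalize (lenSq k)⁻¹ = q
    generalize max 0 (-k.1) = m
    ring
  rw [weightDeriv_self hk] at h1
  have h2 : det4 b a c d = -det4 a b c d := by unfold det4 det3; ring
  have h3 : det4 c a b d = det4 a b c d := by unfold det4 det3; ring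
  have h4 : det4 d a b c = -det4 a b c d := by unfold det4 det3; ring
  have e (x y z : ReVec) : det4 k y x z = -det4 k x y z := by unfold det4 det3; ring
  have e2 (x y z : ReVec) : det4 k x z y = -det4 k x y z := by unfold det4 det3; ring
  have e3 (x y z : ReVec) : det4 k y z x = det4 k x y z := by unfold det4 det3; ring
  rw [h2, h3, h4, e ac b d, e3 ad b c, e2 a bd c]
  linear_combination h1

section Degree

open Set MeasureTheory

/-- The partial derivative of a map to four-space in the direction of a coordinate. -/
def pd {n : ℕ} (K : (Fin n → ℝ) → ReVec) (i : Fin n) (y : Fin n → ℝ) : ReVec :=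
  fderiv ℝ K y (Pi.single i 1)

/-- The second partial derivative of a map to four-space. -/
def pd₂ {n : ℕ} (K : (Fin n → ℝ) → ReVec) (i j : Fin n) (y : Fin n → ℝ) : ReVec :=
  fderiv ℝ (fderiv ℝ K) y (Pi.single i 1) (Pi.single j 1)

section

variable {n : ℕ} {K : (Fin n → ℝ) → ReVec}

lemma pd₂_symm (hK : ContDiff ℝ ⊤ K) (i j : Fin n) (y : Fin n → ℝ) : pd₂ K i j y = pd₂ K j i y :=
  hK.contDiffAt.isSymmSndFDerivAt_of_omega _ _

lemma hasLineDerivAt_pd (hK : ContDiff ℝ ⊤ K) (i : Fin n) (y : Fin n → ℝ) :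
    HasLineDerivAt ℝ K (pd K i y) y (Pi.single i 1) :=
  ((hK.differentiable (by simp)) y).hasFDerivAt.hasLineDerivAt _

lemma contDiff_pd (hK : ContDiff ℝ ⊤ K) (i : Fin n) : ContDiff ℝ ⊤ (pd K i) :=
  (hK.fderiv_right (m := ⊤) (by simp)).clm_apply contDiff_const

lemma hasLineDerivAt_pd₂ (hK : ContDiff ℝ ⊤ K) (i j : Fin n) (y : Fin n → ℝ) :
    HasLineDerivAt ℝ (pd K j) (pd₂ K i j y) y (Pi.single i 1) := by
  have h1 : HasFDerivAt (fderiv ℝ K) (fderiv ℝ (fderiv ℝ K) y) y :=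
    ((hK.fderiv_right (m := ⊤) (by simp)).differentiable (by simp) y).hasFDerivAt
  have h2 := (h1.clm_apply (hasFDerivAt_const (Pi.single j (1 : ℝ) : Fin n → ℝ) y)).hasLineDerivAt
    (Pi.single i 1)
  simp only [_root_.add_apply, ContinuousLinearMap.comp_apply,
    _root_.zero_apply, map_zero, zero_add, ContinuousLinearMap.flip_apply] at h2
  exact h2

/-- The pull-back under `K` of the form `weight v * det4 v`, evaluated on three coordinate
directions. -/
def pullForm (K : (Fin n → ℝ) → ReVec) (i j k : Fin n) (y : Fin n → ℝ) : ℝ :=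
  weight (K y) * det4 (K y) (pd K i y) (pd K j y) (pd K k y)

lemma contDiff_det4 {E : Type*} [NormedAddCommGroup E] [NormedSpace ℝ E] {m : WithTop ℕ∞}
    {u v w z : E → ReVec} (hu : ContDiff ℝ m u) (hv : ContDiff ℝ m v) (hw : ContDiff ℝ m w)
    (hz : ContDiff ℝ m z) : ContDiff ℝ m fun x => det4 (u x) (v x) (w x) (z x) := by
  have key {u : E → ReVec} (hu : ContDiff ℝ m u) :
      ContDiff ℝ m (fun x => (u x).1) ∧ ∀ i, ContDiff ℝ m (fun x => (u x).2 i) :=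
    ⟨hu.fst, fun i => (contDiff_pi.1 hu.snd) i⟩
  obtain ⟨hu, hu'⟩ := key hu
  obtain ⟨hv, hv'⟩ := key hv
  obtain ⟨hw, hw'⟩ := key hw
  obtain ⟨hz, hz'⟩ := key hz
  have d {b c d : E → ReVec} (hb : ∀ i, ContDiff ℝ m (fun x => (b x).2 i))
      (hc : ∀ i, ContDiff ℝ m (fun x => (c x).2 i)) (hd : ∀ i, ContDiff ℝ m (fun x => (d x).2 i)) :
      ContDiff ℝ m fun x => det3 (b x).2 (c x).2 (d x).2 :=
    (((hb 0).mul (((hc 1).mul (hd 2)).sub ((hc 2).mul (hd 1)))).sub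
      ((hb 1).mul (((hc 0).mul (hd 2)).sub ((hc 2).mul (hd 0))))).add
      ((hb 2).mul (((hc 0).mul (hd 1)).sub ((hc 1).mul (hd 0))))
  exact (((hu.mul (d hv' hw' hz')).sub (hv.mul (d hu' hw' hz'))).add (hw.mul (d hu' hv' hz'))).sub
    (hz.mul (d hu' hv' hw'))

lemma differentiableAt_pullForm (hK : ContDiff ℝ ⊤ K) (i j k : Fin n) {y : Fin n → ℝ}
    (h0 : K y ≠ 0) : DifferentiableAt ℝ (pullForm K i j k) y :=
  ((differentiableAt_weight h0).comp y (hK.differentiable (by simp) y)).mul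
    ((contDiff_det4 hK (contDiff_pd hK i) (contDiff_pd hK j) (contDiff_pd hK k)).differentiable
      (by simp) y)

lemma fderiv_pullForm (hK : ContDiff ℝ ⊤ K) (i j k l : Fin n) {y : Fin n → ℝ}
    (h0 : K y ≠ 0) : fderiv ℝ (pullForm K i j k) y (Pi.single l 1) =
      weightDeriv (K y) (pd K l y) * det4 (K y) (pd K i y) (pd K j y) (pd K k y) +
      weight (K y) * (det4 (pd K l y) (pd K i y) (pd K j y) (pd K k y) +
        det4 (K y) (pd₂ K l i y) (pd K j y) (pd K k y) +
        det4 (K y) (pd K i y) (pd₂ K l j y) (pd K k y) +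
        det4 (K y) (pd K i y) (pd K j y) (pd₂ K l k y)) := by
  have h1 := (differentiableAt_pullForm hK i j k h0).hasFDerivAt.hasLineDerivAt (Pi.single l 1)
  have hw := HasDerivAt.weight (hasLineDerivAt_pd hK l y) (by simpa using h0)
  have hd := HasDerivAt.det4 (hasLineDerivAt_pd hK l y) (hasLineDerivAt_pd₂ hK l i y)
    (hasLineDerivAt_pd₂ hK l j y) (hasLineDerivAt_pd₂ hK l k y)
  have h2 := HasDerivAt.unique h1 (hw.mul hd)
  simpa using h2

end

/-- The integral over the unit cube of the pulled back form. -/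
def cubeIntegral (P : (Fin 3 → ℝ) → ReVec) : ℝ :=
  ∫ x in Icc (0 : Fin 3 → ℝ) 1, pullForm P 0 1 2 x

lemma pd_comp_insertNth {K : (Fin 4 → ℝ) → ReVec} (hK : ContDiff ℝ ⊤ K) (b : ℝ) (i : Fin 4)
    (j : Fin 3) (x : Fin 3 → ℝ) :
    pd (fun x => K (i.insertNth b x)) j x = pd K (i.succAbove j) (i.insertNth b x) := by
  have hi : ContDiff ℝ ⊤ (fun x : Fin 3 → ℝ => (i.insertNth b x : Fin 4 → ℝ)) := by
    refine contDiff_pi.2 fun l => ?_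
    refine Fin.succAboveCases i ?_ (fun l => ?_) l
    · simpa using contDiff_const
    · simpa using contDiff_apply ℝ ℝ l
  have h1 := hasLineDerivAt_pd (hK.comp hi) j x
  have h2 := hasLineDerivAt_pd hK (i.succAbove j) (i.insertNth b x)
  refine HasDerivAt.unique h1 ?_
  unfold HasLineDerivAt at h2
  convert h2 using 3 with t
  refine congrArg K (funext fun l => ?_)
  refine Fin.succAboveCases i ?_ (fun l => ?_) l
  · simp
  · simp [Pi.single_apply]

theorem cubeIntegral_insertNth_eq {K : (Fin 4 → ℝ) → ReVec} (hK : ContDiff ℝ ⊤ K)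
    (h0 : ∀ y ∈ Icc (0 : Fin 4 → ℝ) 1, K y ≠ 0)
    (hb : ∀ y ∈ Icc (0 : Fin 4 → ℝ) 1, ∀ i ≠ 0, y i = 0 ∨ y i = 1 → 0 ≤ (K y).1) :
    cubeIntegral (fun x => K ((0 : Fin 4).insertNth 1 x)) =
      cubeIntegral (fun x => K ((0 : Fin 4).insertNth 0 x)) := by
  let V (i : Fin 4) (y : Fin 4 → ℝ) : ℝ :=
    (-1) ^ (i : ℕ) * pullForm K (i.succAbove 0) (i.succAbove 1) (i.succAbove 2) y
  have hV (i : Fin 4) {y : Fin 4 → ℝ} (hy : y ∈ Icc (0 : Fin 4 → ℝ) 1) :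
      DifferentiableAt ℝ (V i) y :=
    (differentiableAt_pullForm hK _ _ _ (h0 y hy)).const_mul _
  have hdiv {y : Fin 4 → ℝ} (hy : y ∈ Icc (0 : Fin 4 → ℝ) 1) :
      ∑ i, fderiv ℝ (V i) y (Pi.single i 1) = 0 := by
    have e (i : Fin 4) : fderiv ℝ (V i) y (Pi.single i 1) = (-1) ^ (i : ℕ) *
        fderiv ℝ (pullForm K (i.succAbove 0) (i.succAbove 1) (i.succAbove 2)) y
          (Pi.single i 1) := by
      simp only [V]
      rw [fderiv_const_mul (differentiableAt_pullForm hK _ _ _ (h0 y hy))]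
      rfl
    simp only [e, fderiv_pullForm hK _ _ _ _ (h0 y hy), Fin.sum_univ_four]
    rw [← det4_divergence (K y) (pd K 0 y) (pd K 1 y) (pd K 2 y) (pd K 3 y) (pd₂ K 0 1 y)
      (pd₂ K 0 2 y) (pd₂ K 0 3 y) (pd₂ K 1 2 y) (pd₂ K 1 3 y) (pd₂ K 2 3 y) (h0 y hy)]
    have s1 : (0 : Fin 4).succAbove 0 = 1 := rfl
    have s2 : (0 : Fin 4).succAbove 1 = 2 := rfl
    have s3 : (0 : Fin 4).succAbove 2 = 3 := rfl
    have s4 : (1 : Fin 4).succAbove 0 = 0 := rfl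
    have s5 : (1 : Fin 4).succAbove 1 = 2 := rfl
    have s6 : (1 : Fin 4).succAbove 2 = 3 := rfl
    have s7 : (2 : Fin 4).succAbove 0 = 0 := rfl
    have s8 : (2 : Fin 4).succAbove 1 = 1 := rfl
    have s9 : (2 : Fin 4).succAbove 2 = 3 := rfl
    have s10 : (3 : Fin 4).succAbove 0 = 0 := rfl
    have s11 : (3 : Fin 4).succAbove 1 = 1 := rfl
    have s12 : (3 : Fin 4).succAbove 2 = 2 := rfl
    simp only [s1, s2, s3, s4, s5, s6, s7, s8, s9, s10, s11, s12, pd₂_symm hK 1 0, pd₂_symm hK 2 0,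
      pd₂_symm hK 3 0, pd₂_symm hK 2 1, pd₂_symm hK 3 1, pd₂_symm hK 3 2]
    simp only [Fin.val_zero, Fin.val_one, Fin.val_two, show ((3 : Fin 4) : ℕ) = 3 from rfl]
    ring
  have hface (i : Fin 4) (hi : i ≠ 0) {b : ℝ} (hb' : b = 0 ∨ b = 1) {x : Fin 3 → ℝ}
      (hx : x ∈ Icc (0 : Fin 3 → ℝ) 1) : V i (i.insertNth b x) = 0 := by
    have hmem : (i.insertNth b x : Fin 4 → ℝ) ∈ Icc (0 : Fin 4 → ℝ) 1 := by
      rw [Fin.insertNth_mem_Icc]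
      refine ⟨?_, hx⟩
      rcases hb' with rfl | rfl <;> simp
    simp only [V, pullForm]
    rw [weight_eq_zero (hb _ hmem i hi (by simpa using hb'))]
    simp
  have hdivI : ∫ y in Icc (0 : Fin 4 → ℝ) 1, ∑ i, fderiv ℝ (V i) y (Pi.single i 1) = 0 := by
    rw [setIntegral_congr_fun measurableSet_Icc (fun y hy => hdiv hy)]
    simp
  have key := integral_divergence_of_hasFDerivAt_off_countable' (0 : Fin 4 → ℝ) 1 zero_le_one V
    (fun i => fderiv ℝ (V i)) ∅ countable_empty
    (fun i y hy => (hV i hy).continuousAt.continuousWithinAt)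
    (fun y hy i => (hV i ⟨fun j => (hy.1 j trivial).1.le, fun j => (hy.1 j trivial).2.le⟩).hasFDerivAt)
    ((integrableOn_congr_fun (fun y hy => hdiv hy) measurableSet_Icc).2 integrableOn_zero)
  rw [hdivI, Fin.sum_univ_four] at key
  have hz (i : Fin 4) (hi : i ≠ 0) {b : ℝ} (hb' : b = 0 ∨ b = 1) :
      ∫ x in Icc (0 : Fin 3 → ℝ) 1, V i (i.insertNth b x) = 0 := by
    rw [setIntegral_congr_fun measurableSet_Icc (fun x hx => hface i hi hb' hx)]
    simp
  have hf (b : ℝ) : ∫ x in Icc (0 : Fin 3 → ℝ) 1, V 0 ((0 : Fin 4).insertNth b x) =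
      cubeIntegral (fun x => K ((0 : Fin 4).insertNth b x)) := by
    unfold cubeIntegral
    congr 1
    funext x
    simp only [V, pullForm, pd_comp_insertNth hK]
    simp
  have c0 (i : Fin 4) : (0 : Fin 4 → ℝ) ∘ i.succAbove = 0 := rfl
  have c1 (i : Fin 4) : (1 : Fin 4 → ℝ) ∘ i.succAbove = 1 := rfl
  simp only [c0, c1, Pi.zero_apply, Pi.one_apply] at key
  rw [hz 1 (by decide) (Or.inl rfl), hz 1 (by decide) (Or.inr rfl), hz 2 (by decide) (Or.inl rfl),
    hz 2 (by decide) (Or.inr rfl), hz 3 (by decide) (Or.inl rfl), hz 3 (by decide) (Or.inr rfl),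
    hf, hf] at key
  linarith

lemma exists_cubeVal_eq {x : Fin 3 → ℝ} (hx : x ∈ Icc (0 : Fin 3 → ℝ) 1) :
    ∃ z : Fin 3 → I, cubeVal z = x :=
  ⟨fun i => ⟨x i, hx.1 i, hx.2 i⟩, rfl⟩

lemma cubeIntegral_eq_of_segment {P Q : (Fin 3 → ℝ) → ReVec} (hP : ContDiff ℝ ⊤ P)
    (hQ : ContDiff ℝ ⊤ Q)
    (hne : ∀ x : Fin 3 → I, ∀ t : ℝ, 0 ≤ t → t ≤ 1 →
      (1 - t) • P (cubeVal x) + t • Q (cubeVal x) ≠ 0)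
    (hb : ∀ x ∈ Cube.boundary (Fin 3), 0 ≤ (P (cubeVal x)).1 ∧ 0 ≤ (Q (cubeVal x)).1) :
    cubeIntegral P = cubeIntegral Q := by
  let K (y : Fin 4 → ℝ) : ReVec := (1 - y 0) • P (Fin.tail y) + y 0 • Q (Fin.tail y)
  have ht : ContDiff ℝ ⊤ (Fin.tail : (Fin 4 → ℝ) → Fin 3 → ℝ) :=
    contDiff_pi.2 fun i => contDiff_apply ℝ ℝ i.succ
  have h0 : ContDiff ℝ ⊤ (fun y : Fin 4 → ℝ => y 0) := contDiff_apply ℝ ℝ 0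
  have hK : ContDiff ℝ ⊤ K :=
    ((contDiff_const.sub h0).smul (hP.comp ht)).add (h0.smul (hQ.comp ht))
  have hmem {y : Fin 4 → ℝ} (hy : y ∈ Icc (0 : Fin 4 → ℝ) 1) :
      ∃ z : Fin 3 → I, cubeVal z = Fin.tail y :=
    exists_cubeVal_eq ⟨fun i => hy.1 i.succ, fun i => hy.2 i.succ⟩
  have key := cubeIntegral_insertNth_eq hK (fun y hy => ?_) (fun y hy i hi h => ?_)
  · symm
    simpa [K] using key
  · obtain ⟨z, hz⟩ := hmem hy
    simp only [K]
    rw [← hz]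
    exact hne z _ (hy.1 0) (hy.2 0)
  · obtain ⟨z, hz⟩ := hmem hy
    obtain ⟨j, rfl⟩ := Fin.exists_succ_eq.2 hi
    have hzj : (z j : ℝ) = y j.succ := congrFun hz j
    have hzb : z ∈ Cube.boundary (Fin 3) := by
      refine ⟨j, h.imp (fun h => ?_) fun h => ?_⟩ <;> exact Subtype.ext (hzj.trans h)
    obtain ⟨h1, h2⟩ := hb z hzb
    have h3 : 0 ≤ y 0 := hy.1 0
    have h4 : y 0 ≤ 1 := hy.2 0
    have h5 : 0 ≤ 1 - y 0 := by linarith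
    simp only [K]
    rw [← hz]
    simp only [Prod.fst_add, Prod.smul_fst, smul_eq_mul]
    positivity

lemma exists_contDiff_near_coords (f : GenLoop (Fin 3) UnitQuat 1) {ε : ℝ} (hε : 0 < ε) :
    ∃ P : (Fin 3 → ℝ) → ReVec, ContDiff ℝ ⊤ P ∧ ∀ x, ‖P (cubeVal x) - coords (f x)‖ < ε :=
  exists_contDiff_near ⟨fun x => coords (f x), continuous_coords.comp f.1.continuous⟩ hε

/-- The degree of a loop in the unit quaternions, up to a normalising constant. -/
def loopDegree (f : GenLoop (Fin 3) UnitQuat 1) : ℝ :=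
  cubeIntegral (exists_contDiff_near_coords f (ε := 1 / 4) (by norm_num)).choose

lemma fst_pos_of_near {f : GenLoop (Fin 3) UnitQuat 1} {v : ReVec} {x : Fin 3 → I}
    (hx : x ∈ Cube.boundary (Fin 3)) (h : ‖v - coords (f x)‖ < 1) : 0 < v.1 := by
  rw [coords_of_mem_boundary f hx] at h
  have := (norm_fst_le _).trans_lt h
  rw [Real.norm_eq_abs, abs_lt] at this
  simp only [Prod.fst_sub] at this
  linarith

lemma loopDegree_eq {f : GenLoop (Fin 3) UnitQuat 1} {Q : (Fin 3 → ℝ) → ReVec}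
    (hQ : ContDiff ℝ ⊤ Q)
    (hne : ∀ x : Fin 3 → I, ∀ t : ℝ, 0 ≤ t → t ≤ 1 →
      (1 - t) • coords (f x) + t • Q (cubeVal x) ≠ 0)
    (hb : ∀ x ∈ Cube.boundary (Fin 3), 0 ≤ (Q (cubeVal x)).1) :
    loopDegree f = cubeIntegral Q := by
  have hc : Continuous fun z : I × (Fin 3 → I) =>
      ‖(1 - (z.1 : ℝ)) • coords (f z.2) + (z.1 : ℝ) • Q (cubeVal z.2)‖ := by
    have h1 : Continuous fun z : I × (Fin 3 → I) => coords (f z.2) :=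
      continuous_coords.comp (f.1.continuous.comp continuous_snd)
    have h2 : Continuous fun z : I × (Fin 3 → I) => Q (cubeVal z.2) :=
      hQ.continuous.comp (continuous_cubeVal.comp continuous_snd)
    fun_prop
  obtain ⟨δ, hδ, hδle⟩ := isCompact_univ.exists_forall_le' hc.continuousOn (a := 0)
    fun z _ => norm_pos_iff.2 (hne z.2 z.1 z.1.2.1 z.1.2.2)
  obtain ⟨P, hP, hPf⟩ := exists_contDiff_near_coords f (lt_min hδ (by norm_num : (0 : ℝ) < 1 / 4))
  obtain ⟨hP₀, hP₀f⟩ := (exists_contDiff_near_coords f (ε := 1 / 4) (by norm_num)).choose_spec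
  rw [loopDegree]
  set P₀ := (exists_contDiff_near_coords f (ε := 1 / 4) (by norm_num)).choose
  trans cubeIntegral P
  · refine cubeIntegral_eq_of_segment hP₀ hP (fun x t h0 h1 h => ?_) fun x hx => ?_
    · have := (convex_ball (coords (f x)) (1 / 4)) (mem_ball_iff_norm.2 (hP₀f x))
        (mem_ball_iff_norm.2 ((hPf x).trans_le (min_le_right _ _))) (sub_nonneg.2 h1) h0 (by ring)
      rw [h, mem_ball_iff_norm, zero_sub, norm_neg] at this
      linarith [half_le_norm_coords (f x)]
    · exact ⟨(fst_pos_of_near hx ((hP₀f x).trans (by norm_num))).le,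
        (fst_pos_of_near hx ((hPf x).trans ((min_le_right _ _).trans_lt (by norm_num)))).le⟩
  · refine cubeIntegral_eq_of_segment hP hQ (fun x t h0 h1 h => ?_) fun x hx => ?_
    · have h2 := hδle (⟨t, h0, h1⟩, x) trivial
      have h3 : (1 - t) • coords (f x) + t • Q (cubeVal x) =
          -((1 - t) • (P (cubeVal x) - coords (f x))) := by
        rw [← sub_eq_zero, ← h]
        module
      simp only at h2
      rw [h3, norm_neg, norm_smul, Real.norm_of_nonneg (sub_nonneg.2 h1)] at h2
      have h4 := (hPf x).trans_le (min_le_left _ _)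
      nlinarith [norm_nonneg (P (cubeVal x) - coords (f x))]
    · exact ⟨(fst_pos_of_near hx ((hPf x).trans ((min_le_right _ _).trans_lt (by norm_num)))).le,
        hb x hx⟩

lemma loopDegree_eq_of_near {f : GenLoop (Fin 3) UnitQuat 1} {P : (Fin 3 → ℝ) → ReVec}
    (hP : ContDiff ℝ ⊤ P) (h : ∀ x, ‖P (cubeVal x) - coords (f x)‖ < 1 / 2) :
    loopDegree f = cubeIntegral P := by
  refine loopDegree_eq hP (fun x t h0 h1 h2 => ?_) fun x hx =>
    (fst_pos_of_near hx ((h x).trans (by norm_num))).le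
  have := (convex_ball (coords (f x)) (1 / 2)) (Metric.mem_ball_self (by norm_num))
    (mem_ball_iff_norm.2 (h x)) (sub_nonneg.2 h1) h0 (by ring)
  rw [h2, mem_ball_iff_norm, zero_sub, norm_neg] at this
  linarith [half_le_norm_coords (f x)]

lemma loopDegree_eq_of_homotopic {f g : GenLoop (Fin 3) UnitQuat 1}
    (h : GenLoop.Homotopic f g) : loopDegree f = loopDegree g := by
  obtain ⟨H⟩ := h
  let F (t : I) : GenLoop (Fin 3) UnitQuat 1 :=
    ⟨⟨fun x => H (t, x), by fun_prop⟩, fun x hx => (H.eq_fst t hx).trans (f.2 x hx)⟩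
  have hu : UniformContinuous fun z : I × (Fin 3 → I) => coords (H z) :=
    CompactSpace.uniformContinuous_of_continuous (continuous_coords.comp H.continuous)
  have hl : IsLocallyConstant fun t => loopDegree (F t) := by
    rw [IsLocallyConstant.iff_eventually_eq]
    intro t
    obtain ⟨δ, hδ, hd⟩ := Metric.uniformContinuous_iff.1 hu (1 / 4) (by norm_num)
    filter_upwards [Metric.ball_mem_nhds t hδ] with s hs
    obtain ⟨P, hP, hPf⟩ := exists_contDiff_near_coords (F t) (by norm_num : (0 : ℝ) < 1 / 4)
    rw [loopDegree_eq_of_near (f := F t) hP fun x => (hPf x).trans (by norm_num)]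
    refine loopDegree_eq_of_near hP fun x => ?_
    have h1 : dist (coords (H (t, x))) (coords (H (s, x))) < 1 / 4 :=
      hd (by rwa [dist_prod_same_right, dist_comm])
    calc ‖P (cubeVal x) - coords (F s x)‖
        ≤ ‖P (cubeVal x) - coords (F t x)‖ + ‖coords (F t x) - coords (F s x)‖ :=
          norm_sub_le_norm_sub_add_norm_sub _ _ _
      _ < 1 / 4 + 1 / 4 := add_lt_add (hPf x) (by rwa [dist_eq_norm] at h1)
      _ = 1 / 2 := by norm_num
  have h0 : F 0 = f := GenLoop.ext _ _ fun x => H.apply_zero x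
  have h1 : F 1 = g := GenLoop.ext _ _ fun x => H.apply_one x
  rw [← h0, ← h1]
  exact hl.apply_eq_of_preconnectedSpace 0 1

/-- The diagonal map halving the first coordinate. -/
def halfLin : (Fin 3 → ℝ) →L[ℝ] (Fin 3 → ℝ) :=
  (Matrix.toLin' (diagonal ![1 / 2, 1, 1])).toContinuousLinearMap

/-- The affine map squeezing the first coordinate of the unit cube to half of the unit interval. -/
def halfMap (s : ℝ) (x : Fin 3 → ℝ) : Fin 3 → ℝ := halfLin x + Pi.single 0 (s / 2)

lemma halfLin_apply (x : Fin 3 → ℝ) (i : Fin 3) :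
    halfLin x i = (![1 / 2, 1, 1] : Fin 3 → ℝ) i * x i := by
  simp only [halfLin, LinearMap.coe_toContinuousLinearMap', toLin'_apply, mulVec_diagonal]

lemma halfMap_zero (s : ℝ) (x : Fin 3 → ℝ) : halfMap s x 0 = (x 0 + s) / 2 := by
  simp only [halfMap, Pi.add_apply, halfLin_apply]
  simp
  ring

lemma halfMap_of_ne (s : ℝ) (x : Fin 3 → ℝ) {i : Fin 3} (hi : i ≠ 0) : halfMap s x i = x i := by
  simp only [halfMap, Pi.add_apply, halfLin_apply]
  fin_cases i <;> simp at hi ⊢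

lemma hasFDerivAt_halfMap (s : ℝ) (x : Fin 3 → ℝ) : HasFDerivAt (halfMap s) halfLin x :=
  halfLin.hasFDerivAt.add_const _

lemma contDiff_halfMap (s : ℝ) : ContDiff ℝ ⊤ (halfMap s) :=
  halfLin.contDiff.add contDiff_const

lemma halfLin_det : halfLin.det = 1 / 2 := by
  rw [ContinuousLinearMap.det, halfLin, LinearMap.coe_toContinuousLinearMap, LinearMap.det_toLin',
    det_diagonal, Fin.prod_univ_three]
  simp

lemma halfMap_injective (s : ℝ) : Function.Injective (halfMap s) := by
  intro x y h
  funext i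
  by_cases hi : i = 0
  · subst hi
    have := congrFun h 0
    rw [halfMap_zero, halfMap_zero] at this
    linarith
  · have := congrFun h i
    rwa [halfMap_of_ne s x hi, halfMap_of_ne s y hi] at this

lemma halfMap_image_Icc (s : ℝ) : halfMap s '' Icc 0 1 =
    {x | (∀ i ≠ 0, x i ∈ Icc (0 : ℝ) 1) ∧ x 0 ∈ Icc (s / 2) ((s + 1) / 2)} := by
  ext x
  constructor
  · rintro ⟨z, hz, rfl⟩
    refine ⟨fun i hi => ?_, ?_⟩
    · rw [halfMap_of_ne s z hi]
      exact ⟨hz.1 i, hz.2 i⟩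
    · rw [halfMap_zero]
      have h0 : 0 ≤ z 0 := hz.1 0
      have h1 : z 0 ≤ 1 := hz.2 0
      constructor <;> linarith
  · rintro ⟨h, h0, h1⟩
    refine ⟨fun i => if i = 0 then 2 * x 0 - s else x i, ⟨fun i => ?_, fun i => ?_⟩, funext fun i => ?_⟩
    · by_cases hi : i = 0
      · simp only [hi, if_true, Pi.zero_apply]
        linarith
      · simpa [hi] using (h i hi).1
    · by_cases hi : i = 0
      · simp only [hi, if_true, Pi.one_apply]
        linarith
      · simpa [hi] using (h i hi).2
    · by_cases hi : i = 0
      · subst hi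
        rw [halfMap_zero]
        simp
      · rw [halfMap_of_ne _ _ hi]
        simp [hi]

lemma pullForm_comp_halfMap {P : (Fin 3 → ℝ) → ReVec} (hP : ContDiff ℝ ⊤ P) (s : ℝ)
    (x : Fin 3 → ℝ) :
    pullForm (fun x => P (halfMap s x)) 0 1 2 x = 1 / 2 * pullForm P 0 1 2 (halfMap s x) := by
  have h (j : Fin 3) : pd (fun x => P (halfMap s x)) j x =
      (![1 / 2, 1, 1] : Fin 3 → ℝ) j • pd P j (halfMap s x) := by
    have h1 := ((hP.differentiable (by simp) (halfMap s x)).hasFDerivAt.comp x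
      (hasFDerivAt_halfMap s x)).fderiv
    have h2 : halfLin (Pi.single j 1) = (![1 / 2, 1, 1] : Fin 3 → ℝ) j • Pi.single j 1 := by
      funext i
      rw [halfLin_apply, Pi.smul_apply, smul_eq_mul]
      by_cases hij : i = j
      · rw [hij]
      · simp [hij]
    unfold pd
    rw [show (fun x => P (halfMap s x)) = P ∘ halfMap s from rfl, h1,
      ContinuousLinearMap.comp_apply, h2, map_smul]
  simp only [pullForm, h]
  simp only [det4, det3]
  simp
  ring

lemma cubeIntegral_comp_halfMap {P : (Fin 3 → ℝ) → ReVec} (hP : ContDiff ℝ ⊤ P) (s : ℝ) :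
    cubeIntegral (fun x => P (halfMap s x)) =
      ∫ x in halfMap s '' Icc 0 1, pullForm P 0 1 2 x := by
  rw [integral_image_eq_integral_abs_det_fderiv_smul volume measurableSet_Icc
    (fun x _ => (hasFDerivAt_halfMap s x).hasFDerivWithinAt) (halfMap_injective s).injOn,
    cubeIntegral]
  simp only [pullForm_comp_halfMap hP, halfLin_det, smul_eq_mul]
  norm_num

lemma cubeIntegral_eq_add {P : (Fin 3 → ℝ) → ReVec} (hP : ContDiff ℝ ⊤ P)
    (h0 : ∀ x, P (cubeVal x) ≠ 0) :
    cubeIntegral P =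
      cubeIntegral (fun x => P (halfMap 0 x)) + cubeIntegral (fun x => P (halfMap 1 x)) := by
  have hunion : halfMap 0 '' Icc 0 1 ∪ halfMap 1 '' Icc 0 1 = Icc 0 1 := by
    rw [halfMap_image_Icc, halfMap_image_Icc]
    ext x
    constructor
    · rintro (⟨h1, h2, h3⟩ | ⟨h1, h2, h3⟩)
      all_goals
        refine ⟨fun i => ?_, fun i => ?_⟩
        · by_cases hi : i = 0
          · subst hi
            simp only [Pi.zero_apply]
            linarith
          · exact (h1 i hi).1
        · by_cases hi : i = 0
          · subst hi
            simp only [Pi.one_apply]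
            linarith
          · exact (h1 i hi).2
    · intro hx
      have h1 : 0 ≤ x 0 := hx.1 0
      have h2 : x 0 ≤ 1 := hx.2 0
      rcases le_total (x 0) (1 / 2) with h | h
      · exact Or.inl ⟨fun i _ => ⟨hx.1 i, hx.2 i⟩, by constructor <;> linarith⟩
      · exact Or.inr ⟨fun i _ => ⟨hx.1 i, hx.2 i⟩, by constructor <;> linarith⟩
  have hcont : ContinuousOn (pullForm P 0 1 2) (Icc 0 1) := fun x hx => by
    obtain ⟨z, rfl⟩ := exists_cubeVal_eq hx
    exact (differentiableAt_pullForm hP _ _ _ (h0 z)).continuousAt.continuousWithinAt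
  have hI : IntegrableOn (pullForm P 0 1 2) (Icc 0 1) :=
    hcont.integrableOn_compact isCompact_Icc
  have hmeas (s : ℝ) : MeasurableSet (halfMap s '' Icc 0 1) :=
    (isCompact_Icc.image (contDiff_halfMap s).continuous).measurableSet
  have hdisj : AEDisjoint volume (halfMap 0 '' Icc 0 1) (halfMap 1 '' Icc 0 1) := by
    refine measure_mono_null ?_ (Measure.pi_hyperplane (fun _ : Fin 3 => (volume : Measure ℝ)) 0
      (1 / 2 : ℝ))
    rw [halfMap_image_Icc, halfMap_image_Icc]
    rintro x ⟨⟨-, -, h1⟩, ⟨-, h2, -⟩⟩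
    rw [mem_ofPred_eq]
    linarith
  rw [cubeIntegral_comp_halfMap hP, cubeIntegral_comp_halfMap hP, cubeIntegral]
  nth_rw 1 [← hunion]
  refine setIntegral_union₀ hdisj (hmeas 1).nullMeasurableSet (hI.mono_set ?_) (hI.mono_set ?_)
  · conv_rhs => rw [← hunion]
    exact subset_union_left
  · conv_rhs => rw [← hunion]
    exact subset_union_right

lemma exists_cubeVal_eq_halfMap (s : I) (x : Fin 3 → I) : ∃ t : I, (t : ℝ) = (x 0 + s) / 2 ∧
    cubeVal (Function.update x 0 t) = halfMap s (cubeVal x) := by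
  refine ⟨⟨(x 0 + s) / 2, ?_, ?_⟩, rfl, funext fun i => ?_⟩
  · linarith [(x 0).2.1, s.2.1]
  · linarith [(x 0).2.2, s.2.2]
  · by_cases hi : i = 0
    · subst hi
      rw [halfMap_zero]
      simp [cubeVal]
    · rw [halfMap_of_ne _ _ hi]
      simp [cubeVal, hi]

lemma loopDegree_transAt (f g : GenLoop (Fin 3) UnitQuat 1) :
    loopDegree (GenLoop.transAt 0 f g) = loopDegree f + loopDegree g := by
  obtain ⟨P, hP, hPf⟩ := exists_contDiff_near_coords (GenLoop.transAt 0 f g)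
    (by norm_num : (0 : ℝ) < 1 / 2)
  have h0 (x : Fin 3 → I) : P (cubeVal x) ≠ 0 := by
    intro h
    have := hPf x
    rw [h, zero_sub, norm_neg] at this
    linarith [half_le_norm_coords (GenLoop.transAt 0 f g x)]
  have hhalf (s : ℝ) : ContDiff ℝ ⊤ fun x => P (halfMap s x) := hP.comp (contDiff_halfMap s)
  rw [loopDegree_eq_of_near hP hPf, cubeIntegral_eq_add hP h0]
  congr 1
  · refine (loopDegree_eq_of_near (hhalf 0) fun x => ?_).symm
    obtain ⟨t, ht, hz⟩ := exists_cubeVal_eq_halfMap 0 x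
    have h := hPf (Function.update x 0 t)
    have ht' : Set.projIcc (0 : ℝ) 1 zero_le_one (2 * t) = x 0 := by
      rw [ht, ← Set.projIcc_val zero_le_one (x 0)]
      congr 1
      simp
      ring
    have hle : (t : ℝ) ≤ 1 / 2 := by
      rw [ht]
      have := (x 0).2.2
      simp only [Set.Icc.coe_zero, add_zero]
      linarith
    rw [hz, GenLoop.transAt, GenLoop.coe_copy] at h
    simpa [if_pos hle, Function.update_self, ht', -one_div] using h
  · refine (loopDegree_eq_of_near (hhalf 1) fun x => ?_).symm
    obtain ⟨t, ht, hz⟩ := exists_cubeVal_eq_halfMap 1 x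
    have h := hPf (Function.update x 0 t)
    rw [hz, GenLoop.transAt, GenLoop.coe_copy] at h
    have ht' : Set.projIcc (0 : ℝ) 1 zero_le_one (2 * t - 1) = x 0 := by
      rw [ht, ← Set.projIcc_val zero_le_one (x 0)]
      congr 1
      simp
      ring
    by_cases hle : (t : ℝ) ≤ 1 / 2
    · have hx0 : (x 0 : ℝ) = 0 := by
        rw [ht] at hle
        have := (x 0).2.1
        simp at hle
        linarith
      have ht1 : Set.projIcc (0 : ℝ) 1 zero_le_one (2 * t) = 1 := by
        rw [← Set.projIcc_val zero_le_one (1 : I)]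
        congr 1
        rw [ht, hx0]
        simp
      have hf : f (Function.update x 0 1) = 1 := f.2 _ ⟨0, Or.inr (by simp)⟩
      have hg : g x = 1 := g.2 _ ⟨0, Or.inl (Subtype.ext hx0)⟩
      rw [hg]
      simpa [if_pos hle, ht1, hf, -one_div] using h
    · simpa [if_neg hle, ht', -one_div] using h

/-- A polynomial map to four-space representing the generator. -/
def polyBump (x : Fin 3 → ℝ) : ReVec :=
  ((2 * (x 0 - 1 / 2)) ^ 2 + (2 * (x 1 - 1 / 2)) ^ 2 + (2 * (x 2 - 1 / 2)) ^ 2 - 1 / 2,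
    (2 : ℝ) • (x - cubeCenter))

lemma contDiff_polyBump : ContDiff ℝ ⊤ polyBump := by
  unfold polyBump
  fun_prop

lemma pd_polyBump (x : Fin 3 → ℝ) (j : Fin 3) :
    pd polyBump j x = (8 * (x j - 1 / 2), (2 : ℝ) • Pi.single j 1) := by
  refine HasDerivAt.unique (hasLineDerivAt_pd contDiff_polyBump j x) ?_
  have hl (i : Fin 3) : HasDerivAt (fun t : ℝ => x i + t * (Pi.single j (1 : ℝ) : Fin 3 → ℝ) i)
      ((Pi.single j (1 : ℝ) : Fin 3 → ℝ) i) 0 := by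
    simpa using ((hasDerivAt_id (0 : ℝ)).mul_const ((Pi.single j (1 : ℝ) : Fin 3 → ℝ) i)).const_add (x i)
  have hs (i : Fin 3) := ((((hl i).sub_const (1 / 2)).const_mul 2).pow 2)
  refine HasDerivAt.prodMk ?_ (hasDerivAt_pi.2 fun i => ?_)
  · refine ((((hs 0).add (hs 1)).add (hs 2)).sub_const (1 / 2)).congr_deriv ?_
    fin_cases j <;> simp <;> ring
  · exact ((hl i).sub_const (1 / 2)).const_mul 2

lemma det4_polyBump (x : Fin 3 → ℝ) :
    det4 (polyBump x) (pd polyBump 0 x) (pd polyBump 1 x) (pd polyBump 2 x) =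
      -(8 * ((2 * (x 0 - 1 / 2)) ^ 2 + (2 * (x 1 - 1 / 2)) ^ 2 + (2 * (x 2 - 1 / 2)) ^ 2) + 4) := by
  have hc (i : Fin 3) : cubeCenter i = 1 / 2 := rfl
  simp only [pd_polyBump, polyBump, det4, det3]
  simp [hc]
  ring

lemma polyBump_ne_zero (x : Fin 3 → ℝ) : polyBump x ≠ 0 := by
  intro h
  have := det4_polyBump x
  rw [h] at this
  simp only [det4, det3, pd_polyBump] at this
  simp at this
  nlinarith [sq_nonneg (x 0 - 1 / 2), sq_nonneg (x 1 - 1 / 2), sq_nonneg (x 2 - 1 / 2)]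

lemma cubeIntegral_polyBump_neg : cubeIntegral polyBump < 0 := by
  have hcont : Continuous (pullForm polyBump 0 1 2) := continuous_iff_continuousAt.2 fun x =>
    (differentiableAt_pullForm contDiff_polyBump _ _ _ (polyBump_ne_zero x)).continuousAt
  rw [← neg_pos, cubeIntegral, ← integral_neg, setIntegral_pos_iff_support_of_nonneg_ae]
  · refine (Metric.measure_ball_pos volume cubeCenter (by norm_num : (0 : ℝ) < 1 / 8)).trans_le
      (measure_mono fun x hx => ?_)
    have hi (i : Fin 3) : |x i - 1 / 2| < 1 / 8 := by
      rw [mem_ball_iff_norm, pi_norm_lt_iff (by norm_num)] at hx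
      exact hx i
    have hi' (i : Fin 3) : (x i - 1 / 2) ^ 2 < (1 / 8) ^ 2 :=
      sq_lt_sq' (abs_lt.1 (hi i)).1 (abs_lt.1 (hi i)).2
    refine ⟨?_, fun i => ?_, fun i => ?_⟩
    · have h1 : (polyBump x).1 < 0 := by
        simp only [polyBump]
        nlinarith [hi' 0, hi' 1, hi' 2]
      have h2 : 0 < weight (polyBump x) := by
        have := lenSq_pos (polyBump_ne_zero x)
        unfold weight
        rw [max_eq_right (by linarith)]
        have h3 : 0 < -(polyBump x).1 := by linarith
        positivity
      refine ne_of_gt ?_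
      simp only [pullForm, det4_polyBump]
      rw [mul_neg, neg_neg]
      positivity
    · have := (abs_lt.1 (hi i)).1
      simp only [Pi.zero_apply]
      linarith
    · have := (abs_lt.1 (hi i)).2
      simp only [Pi.one_apply]
      linarith
  · refine Filter.Eventually.of_forall fun x => ?_
    simp only [pullForm, det4_polyBump, Pi.zero_apply]
    rw [mul_neg, neg_neg]
    have := weight_nonneg (polyBump x)
    positivity
  · exact hcont.neg.continuousOn.integrableOn_compact isCompact_Icc

lemma loopDegree_signLoop_empty : loopDegree (signLoop ∅) ≠ 0 := by
  rw [loopDegree_eq contDiff_polyBump]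
  · exact cubeIntegral_polyBump_neg.ne
  · intro x t h0 h1 h
    set y : Fin 3 → ℝ := (2 : ℝ) • (cubeVal x - cubeCenter) with hy
    have hL : cubeAffine ((2 : ℝ) • signDiag ∅) cubeCenter x = y := by
      simp [cubeAffine, signDiag, smul_mulVec]
      rfl
    have hc : coords (signLoop ∅ x) = ‖toQuat (bumpVec y)‖⁻¹ • bumpVec y := by
      rw [← coords_normalize (bumpVec_ne_zero y), ← hL]
      rfl
    have hκ : 0 < ‖toQuat (bumpVec y)‖⁻¹ := inv_pos.2 (norm_toQuat_pos (bumpVec_ne_zero y))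
    rw [hc] at h
    generalize ‖toQuat (bumpVec y)‖⁻¹ = κ at hκ h
    have h2 := congrArg Prod.snd h
    simp only [bumpVec, polyBump, ← hy, Prod.snd_add, Prod.smul_snd, Prod.snd_zero, smul_smul,
      ← add_smul] at h2
    have hnn : 0 ≤ (1 - t) * (κ * max 0 (1 - ‖y‖)) :=
      mul_nonneg (sub_nonneg.2 h1) (mul_nonneg hκ.le (le_max_left _ _))
    rcases smul_eq_zero.1 h2 with h3 | h3
    · have ht : t = 0 := by linarith
      rw [ht, sub_zero, one_smul, zero_smul, add_zero] at h
      rcases smul_eq_zero.1 h with h4 | h4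
      · exact hκ.ne' h4
      · exact bumpVec_ne_zero y h4
    · have h1' := congrArg Prod.fst h
      have hyi (i : Fin 3) : 2 * (cubeVal x i - 1 / 2) = 0 := congrFun h3 i
      simp only [bumpVec, polyBump, hyi, h3, Prod.fst_add, Prod.smul_fst, Prod.fst_zero,
        smul_eq_mul] at h1'
      simp at h1'
      nlinarith [mul_nonneg (sub_nonneg.2 h1) hκ.le]
  · intro x hx
    obtain ⟨i, hi⟩ := hx
    have h1 : (2 * (cubeVal x i - 1 / 2)) ^ 2 = 1 := by
      rcases hi with hi | hi <;> simp [cubeVal, hi] <;> norm_num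
    simp only [polyBump]
    fin_cases i <;> simp only [Fin.zero_eta, Fin.mk_one, Fin.reduceFinMk] at h1 <;>
      nlinarith [sq_nonneg (2 * (cubeVal x 0 - 1 / 2)), sq_nonneg (2 * (cubeVal x 1 - 1 / 2)),
        sq_nonneg (2 * (cubeVal x 2 - 1 / 2))]

/-- The degree as a homomorphism on the homotopy group. -/
def degreeHom : HomotopyGroup (Fin 3) UnitQuat 1 →* Multiplicative ℝ :=
  MonoidHom.mk' (Quotient.lift (fun f => Multiplicative.ofAdd (loopDegree f))
    fun _ _ h => congrArg _ (loopDegree_eq_of_homotopic h)) fun a b => by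
    obtain ⟨f, rfl⟩ := HomotopyGroup.mk_surjective a
    obtain ⟨g, rfl⟩ := HomotopyGroup.mk_surjective b
    rw [HomotopyGroup.mk_mul_mk 0]
    refine (congrArg Multiplicative.ofAdd (loopDegree_transAt g f)).trans ?_
    rw [add_comm]
    rfl

theorem pi3_unitQuat : Nonempty (HomotopyGroup (Fin 3) UnitQuat 1 ≃* Multiplicative ℤ) := by
  let g : HomotopyGroup (Fin 3) UnitQuat 1 := HomotopyGroup.mk (signLoop ∅)
  have hg : degreeHom g = Multiplicative.ofAdd (loopDegree (signLoop ∅)) := rfl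
  refine ⟨(MulEquiv.ofBijective (zpowersHom _ g) ⟨?_, fun a => ?_⟩).symm⟩
  · rw [injective_iff_map_eq_one]
    intro n hn
    rw [zpowersHom_apply] at hn
    have h1 := congrArg degreeHom hn
    rw [map_zpow, map_one, hg, ← ofAdd_zsmul, ofAdd_eq_one, zsmul_eq_mul] at h1
    rcases mul_eq_zero.1 h1 with h2 | h2
    · exact Multiplicative.toAdd.injective (by exact_mod_cast h2)
    · exact absurd h2 loopDegree_signLoop_empty
  · obtain ⟨n, hn⟩ := Subgroup.mem_zpowers_iff.1 (mem_zpowers_signLoop a)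
    exact ⟨Multiplicative.ofAdd n, hn⟩

end Degree

namespace QuatMatrix

/-- The coordinate vector of a quaternion. -/
def vec (x : ℍ[ℝ]) : Fin 4 → ℝ := ![x.re, x.imI, x.imJ, x.imK]

/-- The quaternion with given coordinate vector. -/
def unvec (v : Fin 4 → ℝ) : ℍ[ℝ] := ⟨v 0, v 1, v 2, v 3⟩

lemma vec_unvec (v : Fin 4 → ℝ) : vec (unvec v) = v := by
  ext i
  fin_cases i <;> rfl

lemma unvec_vec (x : ℍ[ℝ]) : unvec (vec x) = x := by
  apply Quaternion.ext <;> rfl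

lemma vec_injective : Function.Injective vec :=
  Function.LeftInverse.injective unvec_vec

/-- The matrix of left multiplication by a quaternion. -/
def leftMat (p : ℍ[ℝ]) : Matrix (Fin 4) (Fin 4) ℝ :=
  !![p.re, -p.imI, -p.imJ, -p.imK;
     p.imI, p.re, -p.imK, p.imJ;
     p.imJ, p.imK, p.re, -p.imI;
     p.imK, -p.imJ, p.imI, p.re]

/-- The matrix of right multiplication by a quaternion. -/
def rightMat (p : ℍ[ℝ]) : Matrix (Fin 4) (Fin 4) ℝ :=
  !![p.re, -p.imI, -p.imJ, -p.imK;
     p.imI, p.re, p.imK, -p.imJ;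
     p.imJ, -p.imK, p.re, p.imI;
     p.imK, p.imJ, -p.imI, p.re]

/-- The matrix of quaternion conjugation. -/
def conjMat : Matrix (Fin 4) (Fin 4) ℝ := Matrix.diagonal ![1, -1, -1, -1]

lemma leftMat_mulVec (p x : ℍ[ℝ]) : leftMat p *ᵥ vec x = vec (p * x) := by
  ext i
  fin_cases i <;> simp [leftMat, vec, Matrix.mulVec, dotProduct, Fin.sum_univ_four] <;> ring

lemma rightMat_mulVec (p x : ℍ[ℝ]) : rightMat p *ᵥ vec x = vec (x * p) := by
  ext i
  fin_cases i <;> simp [rightMat, vec, Matrix.mulVec, dotProduct, Fin.sum_univ_four] <;> ring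

lemma conjMat_mulVec (x : ℍ[ℝ]) : conjMat *ᵥ vec x = vec (star x) := by
  ext i
  fin_cases i <;> simp [conjMat, vec, Matrix.mulVec_diagonal]

lemma ext_mulVec_vec {A B : Matrix (Fin 4) (Fin 4) ℝ} (h : ∀ x, A *ᵥ vec x = B *ᵥ vec x) :
    A = B := by
  apply Matrix.mulVec_injective
  funext v
  simpa [vec_unvec] using h (unvec v)

lemma det_leftMat (p : ℍ[ℝ]) : (leftMat p).det = Quaternion.normSq p ^ 2 := by
  simp [leftMat, Matrix.det_succ_row_zero, Fin.sum_univ_succ, Fin.succAbove, Quaternion.normSq_def']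
  ring

lemma det_rightMat (p : ℍ[ℝ]) : (rightMat p).det = Quaternion.normSq p ^ 2 := by
  simp [rightMat, Matrix.det_succ_row_zero, Fin.sum_univ_succ, Fin.succAbove, Quaternion.normSq_def']
  ring

lemma det_conjMat : conjMat.det = -1 := by
  simp [conjMat, Matrix.det_diagonal, Fin.prod_univ_four]

lemma transpose_leftMat (p : ℍ[ℝ]) : (leftMat p)ᵀ = leftMat (star p) := by
  ext i j
  fin_cases i <;> fin_cases j <;> simp [leftMat]

lemma transpose_rightMat (p : ℍ[ℝ]) : (rightMat p)ᵀ = rightMat (star p) := by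
  ext i j
  fin_cases i <;> fin_cases j <;> simp [rightMat]

lemma leftMat_mul_leftMat (p q : ℍ[ℝ]) : leftMat p * leftMat q = leftMat (p * q) :=
  ext_mulVec_vec fun x => by simp [← Matrix.mulVec_mulVec, leftMat_mulVec, mul_assoc]

lemma rightMat_mul_rightMat (p q : ℍ[ℝ]) : rightMat p * rightMat q = rightMat (q * p) :=
  ext_mulVec_vec fun x => by simp [← Matrix.mulVec_mulVec, rightMat_mulVec, mul_assoc]

lemma rightMat_mul_leftMat (p q : ℍ[ℝ]) : rightMat q * leftMat p = leftMat p * rightMat q :=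
  ext_mulVec_vec fun x => by
    simp [← Matrix.mulVec_mulVec, rightMat_mulVec, leftMat_mulVec, mul_assoc]

lemma leftMat_one : leftMat 1 = 1 :=
  ext_mulVec_vec fun x => by simp [leftMat_mulVec]

lemma rightMat_one : rightMat 1 = 1 :=
  ext_mulVec_vec fun x => by simp [rightMat_mulVec]

lemma continuous_leftMat : Continuous leftMat := by
  refine continuous_matrix fun i j => ?_
  have h0 := Quaternion.continuous_re
  have h1 := Quaternion.continuous_imI
  have h2 := Quaternion.continuous_imJ
  have h3 := Quaternion.continuous_imK
  fin_cases i <;> fin_cases j <;> simp [leftMat] <;> fun_prop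

lemma continuous_rightMat : Continuous rightMat := by
  refine continuous_matrix fun i j => ?_
  have h0 := Quaternion.continuous_re
  have h1 := Quaternion.continuous_imI
  have h2 := Quaternion.continuous_imJ
  have h3 := Quaternion.continuous_imK
  fin_cases i <;> fin_cases j <;> simp [rightMat] <;> fun_prop

/-- The matrix of `x ↦ p * x * q⁻¹` for unit quaternions `p` and `q`. -/
def rotationHom : UnitQuat × UnitQuat →* Matrix (Fin 4) (Fin 4) ℝ where
  toFun a := leftMat a.1 * rightMat (a.2⁻¹ : UnitQuat)
  map_one' := by simp [leftMat_one, rightMat_one]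
  map_mul' a b := by
    rw [mul_assoc, ← mul_assoc (rightMat _), rightMat_mul_leftMat, mul_assoc (leftMat _) (rightMat _),
      rightMat_mul_rightMat, ← mul_assoc, leftMat_mul_leftMat]
    simp

lemma rotationHom_apply (a : UnitQuat × UnitQuat) :
    rotationHom a = leftMat a.1 * rightMat (a.2⁻¹ : UnitQuat) := rfl

lemma star_mul_self_coe (p : UnitQuat) : star (p : ℍ[ℝ]) * p = 1 := by
  rw [Quaternion.star_mul_self, Quaternion.normSq_eq_norm_mul_self]
  simp

lemma normSq_coe (p : UnitQuat) : Quaternion.normSq (p : ℍ[ℝ]) = 1 := by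
  rw [Quaternion.normSq_eq_norm_mul_self]
  simp

lemma mul_star_self_coe (p : UnitQuat) : (p : ℍ[ℝ]) * star (p : ℍ[ℝ]) = 1 := by
  rw [Quaternion.self_mul_star, Quaternion.normSq_eq_norm_mul_self]
  simp

/-- The rotation of four-space attached to a pair of unit quaternions. -/
def rotation (a : UnitQuat × UnitQuat) : SO4 :=
  ⟨rotationHom a, by
    rw [rotationHom_apply]
    constructor
    · rw [Matrix.transpose_mul, transpose_leftMat, transpose_rightMat, mul_assoc,
        ← mul_assoc (leftMat _), leftMat_mul_leftMat, star_mul_self_coe, leftMat_one, one_mul,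
        rightMat_mul_rightMat, mul_star_self_coe, rightMat_one]
    · rw [Matrix.det_mul, det_leftMat, det_rightMat, normSq_coe, normSq_coe]
      norm_num⟩

lemma continuous_rotation : Continuous rotation := by
  refine Continuous.subtype_mk ?_ _
  exact (continuous_leftMat.comp (continuous_subtype_val.comp continuous_fst)).mul
    (continuous_rightMat.comp (continuous_subtype_val.comp continuous_snd.inv))

lemma rotation_one : rotation 1 = so4One := Subtype.ext (map_one rotationHom)

lemma rotation_eq_iff {a b : UnitQuat × UnitQuat} :
    rotation a = rotation b ↔ b * a⁻¹ ∈ rotationHom.ker := by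
  rw [MonoidHom.mem_ker, rotation, rotation, Subtype.mk.injEq]
  constructor
  · intro h
    rw [map_mul, ← h, ← map_mul, mul_inv_cancel, map_one]
  · intro h
    have : rotationHom (b * a⁻¹ * a) = rotationHom a := by rw [map_mul, h, one_mul]
    rw [← this, inv_mul_cancel_right]

lemma finite_ker_rotationHom : (rotationHom.ker : Set (UnitQuat × UnitQuat)).Finite := by
  refine Set.Finite.subset (Set.Finite.prod (Set.toFinite {(1 : UnitQuat), -1})
    (Set.toFinite {(1 : UnitQuat), -1})) ?_
  rintro ⟨p, q⟩ h
  have h' : leftMat p * rightMat (q⁻¹ : UnitQuat) = 1 := h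
  have key : ∀ x : ℍ[ℝ], (p : ℍ[ℝ]) * x = x * q := by
    intro x
    have := congrArg (fun A => A *ᵥ vec (x * q)) h'
    simp only [← Matrix.mulVec_mulVec, leftMat_mulVec, rightMat_mulVec, Matrix.one_mulVec] at this
    have h2 := vec_injective this
    rwa [mul_assoc x, ← Metric.unitSphere.coe_mul, mul_inv_cancel, Metric.unitSphere.coe_one,
      mul_one] at h2
  have hpq : p = q := Subtype.ext (by simpa using key 1)
  subst hpq
  have hJ (x : ℍ[ℝ]) := congrArg QuaternionAlgebra.imJ (key x)
  have hK (x : ℍ[ℝ]) := congrArg QuaternionAlgebra.imK (key x)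
  simp only [Quaternion.imJ_mul, Quaternion.imK_mul] at hJ hK
  have i1 := hJ ⟨0, 1, 0, 0⟩
  have i2 := hK ⟨0, 1, 0, 0⟩
  have j1 := hK ⟨0, 0, 1, 0⟩
  simp only [mul_zero, zero_mul, mul_one, one_mul] at i1 i2 j1
  have a1 : (p : ℍ[ℝ]).imI = 0 := by linarith
  have a2 : (p : ℍ[ℝ]).imJ = 0 := by linarith
  have a3 : (p : ℍ[ℝ]).imK = 0 := by linarith
  have n := normSq_coe p
  rw [Quaternion.normSq_def', a1, a2, a3] at n
  have hp : p = 1 ∨ p = -1 := by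
    rcases sq_eq_one_iff.1 (by linarith : (p : ℍ[ℝ]).re ^ 2 = 1) with h | h
    · left
      exact Subtype.ext (by apply Quaternion.ext <;> simp [*])
    · right
      exact Subtype.ext (by apply Quaternion.ext <;> simp [*])
  exact ⟨hp, hp⟩

lemma mul_star_mul_self_eq (v x : ℍ[ℝ]) :
    v * star x * v = (2 * inner ℝ v x) • v - ‖v‖ ^ 2 • x := by
  rw [sq, ← Quaternion.normSq_eq_norm_mul_self, Quaternion.normSq_def', Quaternion.inner_def]
  apply Quaternion.ext <;> simp <;> ring

lemma reflection_eq_mul_star_mul {v : ℍ[ℝ]} (hv : v ≠ 0) (x : ℍ[ℝ]) :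
    (ℝ ∙ v)ᗮ.reflection x = -((‖v‖⁻¹ • v) * star x * (‖v‖⁻¹ • v)) := by
  have hn : ‖v‖ ≠ 0 := norm_ne_zero_iff.2 hv
  rw [Submodule.reflection_orthogonal_apply, Submodule.reflection_singleton_apply, smul_mul_assoc,
    smul_mul_assoc, mul_smul_comm, mul_star_mul_self_eq, smul_sub, smul_sub, smul_smul, smul_smul,
    smul_smul, smul_smul, two_nsmul, ← add_smul]
  simp only [RCLike.ofReal_real_eq_id, id_eq]
  congr 2
  · congr 1
    field_simp
    ring
  · rw [show ‖v‖⁻¹ * ‖v‖⁻¹ * ‖v‖ ^ 2 = 1 by field_simp, one_smul]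

/-- A linear isometry of the quaternions is a two-sided multiplication by unit quaternions,
possibly composed with conjugation. -/
lemma isometry_eq_mul (φ : ℍ[ℝ] ≃ₗᵢ[ℝ] ℍ[ℝ]) : ∃ p q : UnitQuat,
    (∀ x, φ x = p * x * q) ∨ ∀ x, φ x = p * star x * q := by
  obtain ⟨l, -, rfl⟩ := φ.reflections_generate_dim
  induction l with
  | nil => exact ⟨1, 1, Or.inl fun x => by simp⟩
  | cons v l ih =>
    obtain ⟨p, q, h⟩ := ih
    simp only [List.map_cons, List.prod_cons, LinearIsometryEquiv.coe_mul, Function.comp_apply]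
    by_cases hv : v = 0
    · refine ⟨p, q, ?_⟩
      have hr (y : ℍ[ℝ]) : (ℝ ∙ v)ᗮ.reflection y = y := by
        rw [Submodule.reflection_orthogonal_apply, Submodule.reflection_singleton_apply, hv]
        simp
      simpa only [hr] using h
    · set u : UnitQuat := ⟨‖v‖⁻¹ • v, by simp [norm_smul, hv]⟩ with hu
      have hr (y : ℍ[ℝ]) : (ℝ ∙ v)ᗮ.reflection y = -(u * star y * u) :=
        reflection_eq_mul_star_mul hv y
      have hstar (r : UnitQuat) : star (r : ℍ[ℝ]) = (r⁻¹ : UnitQuat) :=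
        eq_inv_of_mul_eq_one_left (star_mul_self_coe r)
      refine ⟨-(u * q⁻¹), p⁻¹ * u, ?_⟩
      simp only [hr]
      rcases h with h | h
      · refine Or.inr fun x => ?_
        simp only [h, star_mul, hstar p, hstar q]
        simp [mul_assoc]
      · refine Or.inl fun x => ?_
        simp only [h, star_mul, star_star, hstar p, hstar q]
        simp [mul_assoc]

lemma rotation_surjective : Function.Surjective rotation := by
  rintro ⟨A, hA, hdet⟩
  let f : ℍ[ℝ] →ₗ[ℝ] ℍ[ℝ] :=
    { toFun := fun x => unvec (A *ᵥ vec x)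
      map_add' := fun x y => by
        rw [show vec (x + y) = vec x + vec y by ext i; fin_cases i <;> rfl, Matrix.mulVec_add]
        apply Quaternion.ext <;> rfl
      map_smul' := fun c x => by
        rw [show vec (c • x) = c • vec x by ext i; fin_cases i <;> rfl, Matrix.mulVec_smul]
        apply Quaternion.ext <;> rfl }
  have hf (x) : vec (f x) = A *ᵥ vec x := vec_unvec _
  have hn (x : ℍ[ℝ]) : ‖x‖ * ‖x‖ = vec x ⬝ᵥ vec x := by
    rw [← Quaternion.normSq_eq_norm_mul_self, Quaternion.normSq_def']
    simp [vec, dotProduct, Fin.sum_univ_four]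
    ring
  let φ₀ : ℍ[ℝ] →ₗᵢ[ℝ] ℍ[ℝ] :=
    { f with
      norm_map' := fun x => by
        change ‖f x‖ = ‖x‖
        rw [← sq_eq_sq₀ (norm_nonneg _) (norm_nonneg _), sq, sq, hn, hn, hf,
          Matrix.dotProduct_mulVec, Matrix.vecMul_mulVec, hA, Matrix.vecMul_one] }
  let φ := φ₀.toLinearIsometryEquiv rfl
  have hφ (x) : vec (φ x) = A *ᵥ vec x := hf x
  obtain ⟨p, q, h | h⟩ := isometry_eq_mul φ
  · refine ⟨(p, q⁻¹), Subtype.ext (ext_mulVec_vec fun x => ?_)⟩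
    change (leftMat p * rightMat (q⁻¹⁻¹ : UnitQuat)) *ᵥ _ = A *ᵥ _
    rw [← hφ, h, ← Matrix.mulVec_mulVec, rightMat_mulVec, leftMat_mulVec, inv_inv, mul_assoc]
  · exfalso
    have hA' : A = leftMat p * (rightMat q * conjMat) := ext_mulVec_vec fun x => by
      rw [← hφ, h, ← Matrix.mulVec_mulVec, ← Matrix.mulVec_mulVec, conjMat_mulVec, rightMat_mulVec,
        leftMat_mulVec, mul_assoc]
    rw [hA', Matrix.det_mul, Matrix.det_mul, det_leftMat, det_rightMat, det_conjMat, normSq_coe,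
      normSq_coe] at hdet
    norm_num at hdet

end QuatMatrix

/-- The image of a generalized loop under a pointed continuous map. -/
def GenLoop.map {N X Y : Type*} [TopologicalSpace X] [TopologicalSpace Y] {x : X} {y : Y}
    (h : C(X, Y)) (hx : h x = y) (f : GenLoop N X x) : GenLoop N Y y :=
  ⟨h.comp f.1, fun z hz => (congrArg h (f.2 z hz)).trans hx⟩

namespace HomotopyGroup

section

variable {N X Y : Type*} [DecidableEq N] [Nonempty N] [TopologicalSpace X] [TopologicalSpace Y]
  {x : X} {y : Y}

/-- The homomorphism of homotopy groups induced by a pointed continuous map. -/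
def map (h : C(X, Y)) (hx : h x = y) : HomotopyGroup N X x →* HomotopyGroup N Y y :=
  MonoidHom.mk' (Quotient.map (GenLoop.map h hx) fun _ _ H => H.comp_continuousMap h) fun a b => by
    obtain ⟨i⟩ := ‹Nonempty N›
    obtain ⟨f, rfl⟩ := mk_surjective a
    obtain ⟨g, rfl⟩ := mk_surjective b
    rw [mk_mul_mk i]
    change mk (GenLoop.map h hx _) = mk (GenLoop.map h hx f) * mk (GenLoop.map h hx g)
    rw [mk_mul_mk i]
    congr 1
    ext z
    change h (GenLoop.transAt i g f z) = _
    simp only [GenLoop.transAt, GenLoop.coe_copy]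
    split_ifs <;> rfl

/-- Homotopy groups of a product. -/
def prodEquiv (x : X) (y : Y) :
    HomotopyGroup N (X × Y) (x, y) ≃* HomotopyGroup N X x × HomotopyGroup N Y y :=
  MulEquiv.ofBijective ((map ContinuousMap.fst rfl).prod (map ContinuousMap.snd rfl)) <| by
    constructor
    · intro a b hab
      obtain ⟨f, rfl⟩ := mk_surjective a
      obtain ⟨g, rfl⟩ := mk_surjective b
      obtain ⟨h1, h2⟩ := Prod.ext_iff.1 hab
      obtain ⟨F⟩ := mk_eq_mk_iff.1 h1
      obtain ⟨G⟩ := mk_eq_mk_iff.1 h2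
      exact mk_eq_mk_iff.2 ⟨F.prod G⟩
    · rintro ⟨a, b⟩
      obtain ⟨f, rfl⟩ := mk_surjective a
      obtain ⟨g, rfl⟩ := mk_surjective b
      exact ⟨mk ⟨f.1.prodMk g.1, fun z hz => Prod.ext (f.2 z hz) (g.2 z hz)⟩, rfl⟩

end

end HomotopyGroup

lemma Cube.isPreconnected_face {N : Type*} (i : N) (c : I) :
    IsPreconnected {y : N → I | y i = c} := by
  classical
  have : {y : N → I | y i = c} = Set.univ.pi fun j => if j = i then {c} else Set.univ := by
    ext y
    simp only [Set.mem_ofPred_eq, Set.mem_univ_pi]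
    constructor
    · intro h j
      split_ifs with hj
      · rw [hj]
        exact h
      · trivial
    · intro h
      simpa using h i
  rw [this]
  refine isPreconnected_univ_pi fun j => ?_
  split_ifs
  · exact isPreconnected_singleton
  · exact isPreconnected_univ

lemma Cube.isPreconnected_boundary {N : Type*} [Nontrivial N] :
    IsPreconnected (Cube.boundary N) := by
  classical
  refine isPreconnected_of_forall (fun _ => 0) ?_
  rintro y ⟨i, hi | hi⟩
  · exact ⟨{z | z i = 0}, fun z hz => ⟨i, Or.inl hz⟩, rfl, hi, isPreconnected_face i 0⟩
  · obtain ⟨j, hj⟩ := exists_ne i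
    refine ⟨{z | z i = 1} ∪ {z | z j = 0}, ?_, Or.inr rfl, Or.inl hi,
      (isPreconnected_face i 1).union (Function.update (fun _ => 0) i 1) ?_ ?_
        (isPreconnected_face j 0)⟩
    · rintro z (hz | hz)
      · exact ⟨i, Or.inr hz⟩
      · exact ⟨j, Or.inl hz⟩
    · simp
    · simp [hj]

/-- A covering map lifts generalized loops in dimension at least two. -/
lemma IsCoveringMap.exists_genLoop_lift {N E X : Type*} [Nontrivial N] [TopologicalSpace E]
    [TopologicalSpace X] {p : E → X} (hp : IsCoveringMap p) (e : E) (f : GenLoop N X (p e)) :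
    ∃ g : GenLoop N E e, ∀ y, p (g y) = f y := by
  obtain ⟨i⟩ : Nonempty N := inferInstance
  have h0 : (fun _ => 0 : N → I) ∈ Cube.boundary N := ⟨i, Or.inl rfl⟩
  let H : C(I × (N → I), X) := f.1.comp ⟨fun z j => z.1 * z.2 j, by fun_prop⟩
  have hH0 (y : N → I) : H (0, y) = p e := by
    refine f.2 _ ⟨i, Or.inl ?_⟩
    simp
  have hH1 (y : N → I) : H (1, y) = f y := by
    change f.1 _ = f.1 _
    simp
  let L := hp.liftHomotopy H (ContinuousMap.const _ e) hH0
  have hL (z) : p (L z) = H z := congrFun (hp.liftHomotopy_lifts H _ hH0) z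
  have hL0 (y) : L (0, y) = e := hp.liftHomotopy_zero H _ hH0 y
  have hLb (y) (hy : y ∈ Cube.boundary N) : L (1, y) = L (1, fun _ => 0) := by
    refine hp.constOn_of_comp (g := fun y => L (1, y)) Cube.isPreconnected_boundary
      (by fun_prop) (fun a ha b hb => ?_) hy h0
    rw [hL, hL, hH1, hH1]
    exact (f.2 a ha).trans (f.2 b hb).symm
  have hLe : L (1, fun _ => 0) = L (0, fun _ => 0) := by
    refine hp.constOn_of_comp (g := fun t => L (t, fun _ => 0)) isPreconnected_univ
      (by fun_prop) (fun a _ b _ => ?_) (Set.mem_univ _) (Set.mem_univ _)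
    have h (a : I) : H (a, fun _ => 0) = p e := f.2 _ ⟨i, Or.inl (by simp)⟩
    rw [hL, hL, h, h]
  exact ⟨⟨L.comp ⟨fun y => (1, y), by fun_prop⟩, fun y hy => (hLb y hy).trans (hLe.trans (hL0 _))⟩,
    fun y => (hL (1, y)).trans (hH1 y)⟩

/-- A covering map induces isomorphisms on homotopy groups in dimension at least two. -/
lemma IsCoveringMap.bijective_homotopyGroup_map {N E X : Type*} [DecidableEq N] [Nontrivial N]
    [TopologicalSpace E] [TopologicalSpace X] {p : C(E, X)} (hp : IsCoveringMap p) {e : E} {x : X}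
    (he : p e = x) :
    Function.Bijective (HomotopyGroup.map (N := N) p he) := by
  subst he
  obtain ⟨i⟩ : Nonempty N := inferInstance
  constructor
  · intro a b hab
    obtain ⟨f, rfl⟩ := HomotopyGroup.mk_surjective a
    obtain ⟨g, rfl⟩ := HomotopyGroup.mk_surjective b
    have h := HomotopyGroup.mk_eq_mk_iff.1 hab
    refine HomotopyGroup.mk_eq_mk_iff.2 ((hp.homotopicRel_iff_comp ?_).2 h)
    have h0 : (fun _ => 0 : N → I) ∈ Cube.boundary N := ⟨i, Or.inl rfl⟩
    exact ⟨_, h0, (f.2 _ h0).trans (g.2 _ h0).symm⟩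
  · intro a
    obtain ⟨f, rfl⟩ := HomotopyGroup.mk_surjective a
    obtain ⟨g, hg⟩ := hp.exists_genLoop_lift e f
    exact ⟨HomotopyGroup.mk g, congrArg HomotopyGroup.mk (GenLoop.ext _ _ hg)⟩

lemma QuatMatrix.isCoveringMap_rotation : IsCoveringMap rotation :=
  ((IsQuotientMap.of_surjective_continuous rotation_surjective
    continuous_rotation).isQuotientCoveringMap_of_subgroup rotationHom.ker
      finite_ker_rotationHom.isDiscrete rotation_eq_iff).isCoveringMap

end

/-- the third homotopy group of `SO(4)` is free abelian of rank two:
`π₃(SO(4), 1) ≅ ℤ × ℤ` as groups. -/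
theorem pi3_so4_iso_int_times_int :
    Nonempty ((π_ 3 SO4 so4One) ≃* Multiplicative (ℤ × ℤ)) := by
  obtain ⟨e⟩ := pi3_unitQuat
  have hb : Function.Bijective (HomotopyGroup.map (N := Fin 3)
      ⟨QuatMatrix.rotation, QuatMatrix.continuous_rotation⟩ QuatMatrix.rotation_one) :=
    QuatMatrix.isCoveringMap_rotation.bijective_homotopyGroup_map _
  exact ⟨(MulEquiv.ofBijective _ hb).symm.trans <| (HomotopyGroup.prodEquiv 1 1).trans <|
    (MulEquiv.prodCongr e e).trans (MulEquiv.prodMultiplicative ℤ ℤ).symm⟩
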